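/- Let γ be a simple closed curve in S². Then there exists a homeomorphism f of S² onto itself mapping γ onto a great circle (equivalently, onto the image of the unit circle under a fixed embedding of the equator). -/

import Mathlib

open Metric Set

/-- The plane `ℝ²`. -/
abbrev Plane := EuclideanSpace ℝ (Fin 2)

/-- The 2-sphere, as the unit sphere in `ℝ³`. -/
abbrev Sph := Metric.sphere (0 : EuclideanSpace ℝ (Fin 3)) 1

/-- The unit circle in the plane. -/
abbrev Circle2 := Metric.sphere (0 : Plane) 1

/-- The equator of the 2-sphere: the great circle cut out by the plane `x₂ = 0`. -/
def equator : Set Sph := {x : Sph | (x : EuclideanSpace ℝ (Fin 3)) 2 = 0}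

/-- `f` has a continuous logarithm on `S`. -/
def HasContLog {X : Type*} [TopologicalSpace X] (S : Set X) (f : X → ℂ) : Prop :=
  ∃ g : X → ℂ, ContinuousOn g S ∧ ∀ z ∈ S, Complex.exp (g z) = f z

namespace HasContLog

variable {X : Type*} [TopologicalSpace X] {S T : Set X} {f g : X → ℂ}

theorem mono (h : HasContLog S f) (hT : T ⊆ S) : HasContLog T f :=
  let ⟨L, hL, he⟩ := h
  ⟨L, hL.mono hT, fun z hz => he z (hT hz)⟩

theorem congr (h : HasContLog S f) (hfg : ∀ z ∈ S, f z = g z) : HasContLog S g :=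
  let ⟨L, hL, he⟩ := h
  ⟨L, hL, fun z hz => (he z hz).trans (hfg z hz)⟩

theorem mul (hf : HasContLog S f) (hg : HasContLog S g) : HasContLog S (fun z => f z * g z) :=
  let ⟨L, hL, he⟩ := hf
  let ⟨M, hM, hm⟩ := hg
  ⟨fun z => L z + M z, hL.add hM, fun z hz => by rw [Complex.exp_add, he z hz, hm z hz]⟩

theorem inv (hf : HasContLog S f) : HasContLog S (fun z => (f z)⁻¹) :=
  let ⟨L, hL, he⟩ := hf
  ⟨fun z => -L z, hL.neg, fun z hz => by rw [Complex.exp_neg, he z hz]⟩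

theorem comp {Y : Type*} [TopologicalSpace Y] {R : Set Y} {φ : Y → X} (hf : HasContLog S f)
    (hφ : ContinuousOn φ R) (hm : MapsTo φ R S) : HasContLog R (fun y => f (φ y)) :=
  let ⟨L, hL, he⟩ := hf
  ⟨fun y => L (φ y), hL.comp hφ hm, fun _ hy => he _ (hm hy)⟩

end HasContLog

section Logarithms

variable {X : Type*} [TopologicalSpace X]

theorem hasContLog_const (S : Set X) {c : ℂ} (hc : c ≠ 0) : HasContLog S (fun _ => c) :=
  ⟨fun _ => Complex.log c, continuousOn_const, fun _ _ => Complex.exp_log hc⟩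

theorem hasContLog_of_re_pos {S : Set X} {f : X → ℂ} (hf : ContinuousOn f S)
    (h : ∀ z ∈ S, 0 < (f z).re) : HasContLog S f := by
  refine ⟨fun z => Complex.log (f z), hf.clog fun z hz => Or.inl (h z hz), fun z hz => ?_⟩
  exact Complex.exp_log fun h0 => by have := h z hz; rw [h0] at this; simp at this

/-- Two continuous logarithms of a function on a preconnected set differ by a constant. -/
theorem exists_eqOn_add_const_of_exp_eq {S : Set X} (hS : IsPreconnected S) {g₁ g₂ : X → ℂ}
    (h₁ : ContinuousOn g₁ S) (h₂ : ContinuousOn g₂ S)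
    (h : ∀ z ∈ S, Complex.exp (g₁ z) = Complex.exp (g₂ z)) :
    ∃ c, Complex.exp c = 1 ∧ ∀ z ∈ S, g₁ z = g₂ z + c := by
  rcases S.eq_empty_or_nonempty with rfl | ⟨a, ha⟩
  · exact ⟨0, by simp, by simp⟩
  have hc : Complex.exp (g₁ a - g₂ a) = 1 := by
    rw [Complex.exp_sub, h a ha, div_self (Complex.exp_ne_zero _)]
  refine ⟨g₁ a - g₂ a, hc, ?_⟩
  refine Complex.isCoveringMap_exp.eqOn_of_comp_eqOn hS h₁ (h₂.add continuousOn_const) ?_ ha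
    (by ring)
  intro z hz
  simp only [Function.comp_apply, Subtype.mk.injEq]
  rw [Complex.exp_add, hc, mul_one, h z hz]

open Classical in
theorem HasContLog.glue {A B : Set X} {f : X → ℂ} (hA : HasContLog A f) (hB : HasContLog B f)
    (hAB : IsPreconnected (A ∩ B))
    (hglue : ∀ g : X → ℂ, ContinuousOn g A → ContinuousOn g B → ContinuousOn g (A ∪ B)) :
    HasContLog (A ∪ B) f := by
  obtain ⟨a, ha, hea⟩ := hA
  obtain ⟨b, hb, heb⟩ := hB
  obtain ⟨c, hc, hcab⟩ := exists_eqOn_add_const_of_exp_eq hAB (ha.mono inter_subset_left)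
    (hb.mono inter_subset_right)
    (fun z hz => by rw [hea z hz.1, heb z hz.2])
  have hgA : EqOn (A.piecewise a fun z => b z + c) a A := piecewise_eqOn _ _ _
  have hgB : EqOn (A.piecewise a fun z => b z + c) (fun z => b z + c) B := by
    intro z hz
    by_cases hzA : z ∈ A
    · rw [hgA hzA, hcab z ⟨hzA, hz⟩]
    · rw [piecewise_eq_of_notMem _ _ _ hzA]
  refine ⟨A.piecewise a fun z => b z + c,
    hglue _ (ha.congr hgA) ((hb.add continuousOn_const).congr hgB), ?_⟩
  rintro z (hz | hz)
  · rw [hgA hz, hea z hz]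
  · rw [hgB hz, Complex.exp_add, hc, mul_one, heb z hz]

theorem HasContLog.union_of_isClosed {A B : Set X} {f : X → ℂ} (hA : HasContLog A f)
    (hB : HasContLog B f) (hAB : IsPreconnected (A ∩ B)) (hAc : IsClosed A) (hBc : IsClosed B) :
    HasContLog (A ∪ B) f :=
  hA.glue hB hAB fun _ h₁ h₂ => h₁.union_of_isClosed h₂ hAc hBc

theorem HasContLog.union_of_isOpen {A B : Set X} {f : X → ℂ} (hA : HasContLog A f)
    (hB : HasContLog B f) (hAB : IsPreconnected (A ∩ B)) (hAo : IsOpen A) (hBo : IsOpen B) :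
    HasContLog (A ∪ B) f :=
  hA.glue hB hAB fun _ h₁ h₂ => h₁.union_of_isOpen h₂ hAo hBo

theorem hasContLog_of_continuous [SimplyConnectedSpace X] [LocallyPathConnectedSpace X]
    {f : X → ℂ} (hf : Continuous f) (h0 : ∀ x, f x ≠ 0) : HasContLog univ f := by
  have hu : IsSimplyConnected (univ : Set X) :=
    (Homeomorph.Set.univ X).toHomotopyEquiv.simplyConnectedSpace
  obtain ⟨L, hL, he⟩ := Complex.exists_continuousOn_eqOn_exp_comp hu isOpen_univ
    hf.continuousOn (by simpa using h0)
  exact ⟨L, hL, he⟩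

end Logarithms

section Separation

theorem JoinedIn.hasContLog {S : Set ℂ} {x y : ℂ} (h : JoinedIn Sᶜ x y) :
    HasContLog S (fun z => (z - x) / (z - y)) := by
  obtain ⟨α, hα⟩ := h.symm
  have hne : ∀ (t : unitInterval) (z : S), (z : ℂ) - α t ≠ 0 := fun t z h0 =>
    hα t (by rw [← sub_eq_zero.1 h0]; exact z.2)
  let H : C(unitInterval × S, {z : ℂ // z ≠ 0}) :=
    ⟨fun p => ⟨((p.2 : ℂ) - α p.1) / ((p.2 : ℂ) - α 0),
      div_ne_zero (hne _ _) (hne _ _)⟩, by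
      refine Continuous.subtype_mk (Continuous.div (by fun_prop) (by fun_prop) fun p => hne _ _) _⟩
  have H0 : ∀ z : S, H (0, z) = ⟨Complex.exp ((ContinuousMap.const S (0 : ℂ)) z),
      Complex.exp_ne_zero _⟩ := fun z => by
    ext
    simp [H, div_self (by simpa using hne 0 z)]
  have hl := Complex.isCoveringMap_exp.liftHomotopy_lifts H (.const S 0) H0
  set F := Complex.isCoveringMap_exp.liftHomotopy H (.const S 0) H0
  classical
  refine ⟨fun z => if hz : z ∈ S then F (1, ⟨z, hz⟩) else 0, ?_, fun z hz => ?_⟩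
  · rw [continuousOn_iff_continuous_domRestrict]
    have : S.domRestrict (fun z => if hz : z ∈ S then F (1, ⟨z, hz⟩) else 0) =
        fun z => F (1, z) := by
      ext z
      simp
    rw [this]
    fun_prop
  · have := congr_arg Subtype.val (congr_fun hl (1, ⟨z, hz⟩))
    simpa [hz, H] using this

/-- No nonzero power of `z - x` has a continuous logarithm on a circle around `x`. -/
theorem not_hasContLog_sphere_pow {x : ℂ} {R : ℝ} (hR : 0 < R) {n : ℕ} (hn : n ≠ 0) :
    ¬ HasContLog (sphere x R) (fun z => (z - x) ^ n) := by
  rintro ⟨g, hg, he⟩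
  have hmem : ∀ t : ℝ, circleMap x R t ∈ sphere x R := fun t => circleMap_mem_sphere x hR.le t
  have hcont : ContinuousOn (fun t : ℝ => g (circleMap x R t)) univ :=
    hg.comp (continuous_circleMap x R).continuousOn fun t _ => hmem t
  obtain ⟨c, -, hc⟩ := exists_eqOn_add_const_of_exp_eq (S := (univ : Set ℝ)) isPreconnected_univ
    (g₂ := fun t : ℝ => n * (Real.log R + t * Complex.I)) hcont (by fun_prop) fun t _ => by
      rw [he _ (hmem t), Complex.exp_nat_mul, Complex.exp_add, ← Complex.ofReal_exp,
        Real.exp_log hR]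
      simp [circleMap]
  have h0 := hc 0 trivial
  have h1 := hc (2 * Real.pi) trivial
  have hp : circleMap x R (2 * Real.pi) = circleMap x R 0 := by simp [circleMap]
  rw [hp, h0] at h1
  have h2 : (n : ℂ) * ((2 * Real.pi : ℝ) * Complex.I) = 0 := by
    push_cast at h1 ⊢
    linear_combination -h1
  simp [hn, Real.pi_ne_zero] at h2

/-- A bounded open set whose frontier lies in `K` detects the winding of `(z - x) ^ n * q`
around its point `x`. -/
theorem not_hasContLog_of_mem_bounded {K W : Set ℂ} (hK : IsClosed K)
    (hWb : Bornology.IsBounded W) (hfr : frontier W ⊆ K) {x : ℂ} (hx : x ∈ W) {n : ℕ} (hn : n ≠ 0)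
    {q : ℂ → ℂ} (hq : ContinuousOn q (closure W)) (hq0 : ∀ z ∈ closure W, q z ≠ 0) :
    ¬ HasContLog K (fun z => (z - x) ^ n * q z) := by
  classical
  rintro ⟨g, hg, he⟩
  obtain ⟨G, hG⟩ := ContinuousMap.exists_restrict_eq hK
    (⟨K.domRestrict g, continuousOn_iff_continuous_domRestrict.1 hg⟩ : C(K, ℂ))
  have hGK : ∀ z ∈ K, G z = g z := fun z hz => DFunLike.congr_fun hG ⟨z, hz⟩
  let Φ : ℂ → ℂ := W.piecewise (fun z => Complex.exp (G z) / q z) (fun z => (z - x) ^ n)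
  have hΦ : Continuous Φ := by
    refine continuous_piecewise ?_ ?_ (by fun_prop)
    · intro z hz
      have hzc := frontier_subset_closure hz
      rw [hGK z (hfr hz), he z (hfr hz), mul_div_cancel_right₀ _ (hq0 z hzc)]
    · exact (by fun_prop : Continuous fun z => Complex.exp (G z)).continuousOn.div hq hq0
  have hΦ0 : ∀ z, Φ z ≠ 0 := by
    intro z
    by_cases hz : z ∈ W
    · simp only [Φ, piecewise_eq_of_mem _ _ _ hz]
      exact div_ne_zero (Complex.exp_ne_zero _) (hq0 z (subset_closure hz))
    · simp only [Φ, piecewise_eq_of_notMem _ _ _ hz]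
      exact pow_ne_zero _ (sub_ne_zero.2 fun h => hz (h ▸ hx))
  obtain ⟨R, hR⟩ := hWb.subset_ball x
  have hR0 : 0 < R := pos_of_mem_ball (hR hx)
  refine not_hasContLog_sphere_pow (x := x) hR0 hn
    (((hasContLog_of_continuous hΦ hΦ0).mono (subset_univ _)).congr fun z hz => ?_)
  refine piecewise_eq_of_notMem _ _ _ fun hzW => ?_
  have := hR hzW
  rw [mem_ball, mem_sphere.1 hz] at this
  exact this.false

theorem frontier_connectedComponentIn_subset {K : Set ℂ} (hK : IsClosed K) (x : ℂ) :
    frontier (connectedComponentIn Kᶜ x) ⊆ K := by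
  intro z hz
  by_contra hzK
  have ho := hK.isOpen_compl.connectedComponentIn (x := x)
  rw [ho.frontier_eq] at hz
  have hmem : connectedComponentIn Kᶜ z ∈ nhds z :=
    (hK.isOpen_compl.connectedComponentIn (x := z)).mem_nhds (mem_connectedComponentIn hzK)
  obtain ⟨w, hw1, hw2⟩ := mem_closure_iff_nhds.1 hz.1 _ hmem
  apply hz.2
  rw [connectedComponentIn_eq hw2, ← connectedComponentIn_eq hw1] at *
  exact mem_connectedComponentIn hzK

theorem joinedIn_of_mem_connectedComponentIn {K : Set ℂ} (hK : IsClosed K) {x y : ℂ}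
    (h : y ∈ connectedComponentIn Kᶜ x) : JoinedIn Kᶜ x y := by
  have hx : x ∈ Kᶜ := by
    by_contra hx
    rw [connectedComponentIn_eq_empty hx] at h
    exact h
  have hc : IsConnected (connectedComponentIn Kᶜ x) := isConnected_connectedComponentIn_iff.2 hx
  have hp := (hK.isOpen_compl.connectedComponentIn.isConnected_iff_isPathConnected).1 hc
  exact (hp.joinedIn x (mem_connectedComponentIn hx) y h).mono (connectedComponentIn_subset _ _)

theorem IsPreconnected.joinedIn_compl {K P : Set ℂ} (hK : IsClosed K) (hP : IsPreconnected P)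
    (hPK : Disjoint P K) {x y : ℂ} (hx : x ∈ P) (hy : y ∈ P) : JoinedIn Kᶜ x y :=
  joinedIn_of_mem_connectedComponentIn hK
    (hP.subset_connectedComponentIn hx hPK.subset_compl_right hy)

/-- Far away points are joined in the complement of a bounded set. -/
theorem joinedIn_compl_of_norm_gt {K : Set ℂ} (hKc : IsClosed K) {R : ℝ} (hK : K ⊆ closedBall 0 R)
    {x y : ℂ} (hx : R < ‖x‖) (hy : R < ‖y‖) : JoinedIn Kᶜ x y := by
  rcases lt_or_ge R 0 with hR | hR
  · have : K = ∅ := by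
      rw [closedBall_eq_empty.2 hR] at hK
      exact subset_empty_iff.1 hK
    rw [this, compl_empty]
    exact isPathConnected_univ.joinedIn _ trivial _ trivial
  · obtain ⟨r, hRr, hr⟩ := exists_between (lt_min hx hy)
    have hr0 : 0 < r := hR.trans_lt hRr
    have hmem : ∀ {z : ℂ}, r < ‖z‖ → z ∈ Complex.exp '' {w : ℂ | Real.log r < w.re} := by
      intro z hz
      refine ⟨Complex.log z, ?_, Complex.exp_log (norm_pos_iff.1 (hr0.trans hz))⟩
      simpa [Complex.log_re] using Real.log_lt_log hr0 hz
    refine ((convex_halfSpace_re_gt (Real.log r)).isPreconnected.image _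
      Complex.continuous_exp.continuousOn).joinedIn_compl hKc ?_
      (hmem (hr.trans_le (min_le_left _ _))) (hmem (hr.trans_le (min_le_right _ _)))
    rw [disjoint_left]
    rintro _ ⟨w, hw, rfl⟩ hwK
    have h1 := hK hwK
    rw [mem_closedBall_zero_iff, Complex.norm_exp] at h1
    have h2 := Real.exp_lt_exp.2 (show Real.log r < w.re from hw)
    rw [Real.exp_log hr0] at h2
    linarith

/-- **Eilenberg's criterion**: two points in the complement of a compact plane set are joined there
as soon as the quotient `(z - x) / (z - y)` has a continuous logarithm on it. -/
theorem HasContLog.joinedIn {K : Set ℂ} (hK : IsCompact K) {x y : ℂ} (hx : x ∉ K) (hy : y ∉ K)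
    (h : HasContLog K (fun z => (z - x) / (z - y))) : JoinedIn Kᶜ x y := by
  have key : ∀ {x y : ℂ}, x ∉ K → y ∉ K → HasContLog K (fun z => (z - x) / (z - y)) →
      Bornology.IsBounded (connectedComponentIn Kᶜ x) → JoinedIn Kᶜ x y := by
    intro x y hx hy h hb
    by_contra hj
    have hfr := frontier_connectedComponentIn_subset hK.isClosed x
    have hyW : y ∉ connectedComponentIn Kᶜ x := fun hyW =>
      hj (joinedIn_of_mem_connectedComponentIn hK.isClosed hyW)
    have hW := hK.isClosed.isOpen_compl.connectedComponentIn (x := x)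
    have hycl : ∀ z ∈ closure (connectedComponentIn Kᶜ x), z - y ≠ 0 := by
      intro z hz h0
      rw [sub_eq_zero] at h0
      subst h0
      exact hy (hfr (hW.frontier_eq ▸ ⟨hz, hyW⟩))
    refine not_hasContLog_of_mem_bounded hK.isClosed hb hfr
      (mem_connectedComponentIn hx) one_ne_zero (q := fun z => (z - y)⁻¹) ?_ ?_
      (h.congr fun z _ => by rw [pow_one, div_eq_mul_inv])
    · exact ContinuousOn.inv₀ (by fun_prop) hycl
    · exact fun z hz => inv_ne_zero (hycl z hz)
  by_cases hbx : Bornology.IsBounded (connectedComponentIn Kᶜ x)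
  · exact key hx hy h hbx
  by_cases hby : Bornology.IsBounded (connectedComponentIn Kᶜ y)
  · exact (key hy hx (h.inv.congr fun z _ => inv_div _ _) hby).symm
  obtain ⟨R, hR⟩ := hK.isBounded.subset_closedBall 0
  have aux : ∀ {x : ℂ}, ¬ Bornology.IsBounded (connectedComponentIn Kᶜ x) →
      ∃ w ∈ connectedComponentIn Kᶜ x, R < ‖w‖ := by
    intro x hu
    by_contra! hcon
    exact hu ((isBounded_closedBall (x := (0 : ℂ)) (r := R)).subset fun w hw => by
      simpa using hcon w hw)
  obtain ⟨u, hu, hRu⟩ := aux hbx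
  obtain ⟨v, hv, hRv⟩ := aux hby
  exact ((joinedIn_of_mem_connectedComponentIn hK.isClosed hu).trans
    (joinedIn_compl_of_norm_gt hK.isClosed hR hRu hRv)).trans
    (joinedIn_of_mem_connectedComponentIn hK.isClosed hv).symm

/-- **Janiszewski's theorem**. -/
theorem JoinedIn.janiszewski {A B : Set ℂ} (hA : IsCompact A) (hB : IsCompact B)
    (hAB : IsPreconnected (A ∩ B)) {x y : ℂ} (hxyA : JoinedIn Aᶜ x y) (hxyB : JoinedIn Bᶜ x y) :
    JoinedIn (A ∪ B)ᶜ x y :=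
  (hxyA.hasContLog.union_of_isClosed hxyB.hasContLog hAB hA.isClosed hB.isClosed).joinedIn
    (hA.union hB) (by simpa using ⟨hxyA.source_mem, hxyB.source_mem⟩)
    (by simpa using ⟨hxyA.target_mem, hxyB.target_mem⟩)

end Separation

section Curves

/-- A function that is constant on the fibres of `c` over a compact set descends to the image. -/
theorem exists_continuousOn_comp_eq {X Y Z : Type*} [TopologicalSpace X] [TopologicalSpace Y]
    [T2Space Y] [TopologicalSpace Z] [T2Space X] [Nonempty Z] {K : Set X} (hK : IsCompact K)
    {c : X → Y} (hc : ContinuousOn c K) {L : X → Z} (hL : ContinuousOn L K)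
    (h : ∀ s ∈ K, ∀ t ∈ K, c s = c t → L s = L t) :
    ∃ g : Y → Z, ContinuousOn g (c '' K) ∧ ∀ t ∈ K, g (c t) = L t := by
  classical
  obtain ⟨z₀⟩ := ‹Nonempty Z›
  let g : Y → Z := fun y => if hy : ∃ t ∈ K, c t = y then L hy.choose else z₀
  have hg : ∀ t ∈ K, g (c t) = L t := by
    intro t ht
    have hy : ∃ s ∈ K, c s = c t := ⟨t, ht, rfl⟩
    simp only [g, dif_pos hy]
    exact h _ hy.choose_spec.1 _ ht hy.choose_spec.2
  refine ⟨g, continuousOn_iff_isClosed.2 fun T hT => ⟨c '' (K ∩ L ⁻¹' T), ?_, ?_⟩, hg⟩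
  · exact ((hK.of_isClosed_subset (hL.preimage_isClosed_of_isClosed hK.isClosed hT)
      inter_subset_left).image_of_continuousOn (hc.mono inter_subset_left)).isClosed
  · ext y
    constructor
    · rintro ⟨hy, t, ht, rfl⟩
      exact ⟨⟨t, ⟨ht, by rwa [mem_preimage, hg t ht] at hy⟩, rfl⟩, t, ht, rfl⟩
    · rintro ⟨⟨t, ⟨ht, htT⟩, rfl⟩, hy⟩
      exact ⟨by rwa [mem_preimage, hg t ht], hy⟩

/-- A nonvanishing continuous function on an arc has a continuous logarithm. -/
theorem hasContLog_image_Icc {c : ℝ → ℂ} {a b : ℝ} (hc : ContinuousOn c (Icc a b))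
    (hinj : InjOn c (Icc a b)) {f : ℂ → ℂ} (hf : ContinuousOn f (c '' Icc a b))
    (h0 : ∀ z ∈ c '' Icc a b, f z ≠ 0) : HasContLog (c '' Icc a b) f := by
  rcases lt_or_ge b a with hab | hab
  · rw [Icc_eq_empty hab.not_ge, image_empty]
    exact ⟨0, continuousOn_empty _, by simp⟩
  have hfc : Continuous (IccExtend hab ((Icc a b).domRestrict (f ∘ c))) :=
    (continuousOn_iff_continuous_domRestrict.1
      (hf.comp hc (mapsTo_image c _))).Icc_extend'
  obtain ⟨L, hL, he⟩ := hasContLog_of_continuous hfc fun t => by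
    simpa [IccExtend] using h0 _ ⟨_, (projIcc a b hab t).2, rfl⟩
  obtain ⟨g, hg, hgc⟩ := exists_continuousOn_comp_eq isCompact_Icc hc
    (hL.mono (subset_univ (Icc a b))) fun s hs t ht hst => by rw [hinj hs ht hst]
  refine ⟨g, hg, ?_⟩
  rintro _ ⟨t, ht, rfl⟩
  rw [hgc t ht, he t trivial, IccExtend_of_mem _ _ ht]
  rfl

/-- **An arc does not separate the plane.** -/
theorem joinedIn_compl_image_Icc {c : ℝ → ℂ} {a b : ℝ} (hc : ContinuousOn c (Icc a b))
    (hinj : InjOn c (Icc a b)) {x y : ℂ} (hx : x ∉ c '' Icc a b) (hy : y ∉ c '' Icc a b) :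
    JoinedIn (c '' Icc a b)ᶜ x y := by
  refine HasContLog.joinedIn (isCompact_Icc.image_of_continuousOn hc) hx hy
    (hasContLog_image_Icc hc hinj (ContinuousOn.div (by fun_prop) (by fun_prop) ?_) ?_)
  · exact fun z hz h => hy (sub_eq_zero.1 h ▸ hz)
  · exact fun z hz => div_ne_zero (fun h => hx (sub_eq_zero.1 h ▸ hz))
      (fun h => hy (sub_eq_zero.1 h ▸ hz))

/-- A continuous `1`-periodic parametrisation of a simple closed curve, injective on a period. -/
structure IsJordanParam (c : ℝ → ℂ) : Prop where
  continuous : Continuous c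
  eq_iff : ∀ s t, c s = c t ↔ ∃ n : ℤ, s = t + n

namespace IsJordanParam

variable {c : ℝ → ℂ}

theorem injOn_Ico (h : IsJordanParam c) (a : ℝ) : InjOn c (Ico a (a + 1)) := by
  intro s hs t ht hst
  obtain ⟨n, hn⟩ := (h.eq_iff s t).1 hst
  have h1 : (n : ℝ) < (1 : ℤ) := by push_cast; linarith [hs.2, ht.1]
  have h2 : ((-1 : ℤ) : ℝ) < n := by push_cast; linarith [hs.1, ht.2]
  rw [Int.cast_lt] at h1 h2
  have : n = 0 := by omega
  simpa [this] using hn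

theorem eq_of_mem_Ico (h : IsJordanParam c) {a s t : ℝ} (hs : s ∈ Ico a (a + 1))
    (ht : t ∈ Ico a (a + 1)) (hst : c s = c t) : s = t :=
  h.injOn_Ico a hs ht hst

theorem injOn_Icc (h : IsJordanParam c) {a b : ℝ} (hab : b < a + 1) : InjOn c (Icc a b) :=
  (h.injOn_Ico a).mono (Icc_subset_Ico_right hab)

theorem add_one (h : IsJordanParam c) (t : ℝ) : c (t + 1) = c t :=
  (h.eq_iff _ _).2 ⟨1, by simp⟩

theorem exists_mem_Ico (h : IsJordanParam c) (a : ℝ) {z : ℂ} (hz : z ∈ range c) :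
    ∃ t ∈ Ico a (a + 1), c t = z := by
  obtain ⟨t, rfl⟩ := hz
  refine ⟨toIcoMod one_pos a t, toIcoMod_mem_Ico _ _ _, (h.eq_iff _ _).2 ⟨-toIcoDiv one_pos a t, ?_⟩⟩
  simp [toIcoMod, sub_eq_add_neg]

theorem image_Icc (h : IsJordanParam c) (a : ℝ) : c '' Icc a (a + 1) = range c :=
  (image_subset_range _ _).antisymm fun _ hz =>
    let ⟨t, ht, e⟩ := h.exists_mem_Ico a hz
    ⟨t, Ico_subset_Icc_self ht, e⟩

theorem isCompact_range (h : IsJordanParam c) : IsCompact (range c) := by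
  rw [← h.image_Icc 0]
  exact isCompact_Icc.image h.continuous

theorem diff_singleton (h : IsJordanParam c) (t₀ : ℝ) :
    range c \ {c t₀} = c '' Ioo t₀ (t₀ + 1) := by
  ext z
  constructor
  · rintro ⟨hz, hzt⟩
    obtain ⟨t, ht, rfl⟩ := h.exists_mem_Ico t₀ hz
    refine ⟨t, ⟨lt_of_le_of_ne ht.1 ?_, ht.2⟩, rfl⟩
    rintro rfl
    exact hzt rfl
  · rintro ⟨t, ht, rfl⟩
    refine ⟨mem_range_self _, fun he => ?_⟩
    have := h.eq_of_mem_Ico (a := t₀) ⟨ht.1.le, ht.2⟩ ⟨le_rfl, by linarith⟩ he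
    exact ht.1.ne' this

theorem isPreconnected_diff_singleton (h : IsJordanParam c) (p : ℂ) :
    IsPreconnected (range c \ {p}) := by
  by_cases hp : p ∈ range c
  · obtain ⟨t, rfl⟩ := hp
    rw [h.diff_singleton]
    exact isPreconnected_Ioo.image _ h.continuous.continuousOn
  · rw [sdiff_singleton_eq_self hp]
    exact isPreconnected_range h.continuous

/-- The part of the curve outside a ball around one of its points lies on a proper subarc. -/
theorem exists_arc_of_notMem_ball (h : IsJordanParam c) (t₀ : ℝ) {ε : ℝ} (hε : 0 < ε) :
    ∃ a b, b < a + 1 ∧ c t₀ ∉ c '' Icc a b ∧ range c \ ball (c t₀) ε ⊆ c '' Icc a b := by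
  obtain ⟨δ, hδ, hball⟩ := Metric.continuousAt_iff.1 (h.continuous.continuousAt (x := t₀)) ε hε
  refine ⟨t₀ + δ, t₀ + 1 - δ, by linarith, ?_, ?_⟩
  · rintro ⟨t, ht, he⟩
    have := h.eq_of_mem_Ico (a := t₀) (s := t) ⟨by linarith [ht.1], by linarith [ht.2]⟩
      ⟨le_rfl, by linarith⟩ he
    linarith [ht.1]
  · rintro z ⟨hz, hzb⟩
    obtain ⟨t, ht, rfl⟩ := h.exists_mem_Ico t₀ hz
    refine ⟨t, ⟨?_, ?_⟩, rfl⟩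
    · by_contra! hlt
      refine hzb (hball ?_)
      rw [Real.dist_eq, abs_lt]
      constructor <;> linarith [ht.1]
    · by_contra! hlt
      refine hzb ?_
      rw [mem_ball, ← h.add_one t₀]
      have hb : dist (c (t - 1)) (c t₀) < ε := hball (by
        rw [Real.dist_eq, abs_lt]
        constructor <;> linarith [ht.2])
      rwa [← h.add_one (t - 1), ← h.add_one t₀, sub_add_cancel] at hb

/-- A set of small diameter on the curve lies on a subarc of small diameter. -/
theorem exists_small_arc (h : IsJordanParam c) {ε : ℝ} (hε : 0 < ε) :
    ∃ η > 0, ∀ D ⊆ range c, (∀ z ∈ D, ∀ w ∈ D, dist z w < η) →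
      ∃ A ⊆ range c, IsCompact A ∧ IsPreconnected A ∧ D ⊆ A ∧ ∀ z ∈ A, ∀ w ∈ A, dist z w ≤ ε := by
  obtain ⟨δ, hδ, hδε⟩ := Metric.uniformContinuousOn_iff.1
    (isCompact_Icc.uniformContinuousOn_of_continuous h.continuous.continuousOn
      : UniformContinuousOn c (Icc (-1) 2)) ε hε
  set r := min (δ / 3) (1 / 3) with hr
  have hr0 : 0 < r := by positivity
  have hrδ : 3 * r ≤ δ := by have := min_le_left (δ / 3) (1 / 3); linarith
  have hr1 : 3 * r ≤ 1 := by have := min_le_right (δ / 3) (1 / 3); linarith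
  let Q : Set (ℝ × ℝ) := Icc 0 1 ×ˢ Icc r (1 - r)
  have hQ : IsCompact Q := isCompact_Icc.prod isCompact_Icc
  have hpos : ∀ q ∈ Q, 0 < dist (c q.1) (c (q.1 + q.2)) := by
    rintro ⟨t, u⟩ ⟨-, hu1, hu2⟩
    refine dist_pos.2 fun he => ?_
    simp only at he hu1 hu2
    have := h.eq_of_mem_Ico (a := t) (s := t) (t := t + u) ⟨le_rfl, by linarith⟩
      ⟨by linarith, by linarith⟩ he
    linarith
  obtain ⟨η, hη, hηQ⟩ : ∃ η > 0, ∀ q ∈ Q, η ≤ dist (c q.1) (c (q.1 + q.2)) := by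
    have hc := h.continuous
    exact hQ.exists_forall_le' (f := fun q : ℝ × ℝ => dist (c q.1) (c (q.1 + q.2)))
      (by fun_prop) hpos
  refine ⟨η, hη, fun D hD hDη => ?_⟩
  rcases D.eq_empty_or_nonempty with rfl | ⟨z₀, hz₀⟩
  · exact ⟨∅, empty_subset _, isCompact_empty, isPreconnected_empty, subset_rfl, by simp⟩
  obtain ⟨t₀, ht₀, rfl⟩ := h.exists_mem_Ico 0 (hD hz₀)
  refine ⟨c '' Icc (t₀ - r) (t₀ + r), image_subset_range _ _, isCompact_Icc.image h.continuous,
    isPreconnected_Icc.image _ h.continuous.continuousOn, ?_, ?_⟩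
  · intro w hw
    obtain ⟨s, hs, rfl⟩ := h.exists_mem_Ico (t₀ - r) (hD hw)
    refine ⟨s, ⟨hs.1, ?_⟩, rfl⟩
    by_contra! hlt
    have h1 := hηQ (t₀, s - t₀) ⟨⟨ht₀.1, by simpa using ht₀.2.le⟩, by linarith, by linarith [hs.2]⟩
    simp only [add_sub_cancel] at h1
    exact (hDη _ hz₀ _ hw).not_ge h1
  · rintro _ ⟨s, hs, rfl⟩ _ ⟨t, ht, rfl⟩
    refine (hδε s ?_ t ?_ ?_).le
    · constructor <;> linarith [hs.1, hs.2, ht₀.1, ht₀.2]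
    · constructor <;> linarith [ht.1, ht.2, ht₀.1, ht₀.2]
    · rw [Real.dist_eq, abs_lt]
      constructor <;> linarith [hs.1, hs.2, ht.1, ht.2]

/-- Along the curve a nonvanishing function has a logarithm with some increment `2πik`. -/
theorem exists_winding (h : IsJordanParam c) {f : ℂ → ℂ} (hf : ContinuousOn f (range c))
    (h0 : ∀ z ∈ range c, f z ≠ 0) :
    ∃ L : ℝ → ℂ, ∃ k : ℤ, Continuous L ∧ (∀ t, Complex.exp (L t) = f (c t)) ∧
      L 1 = L 0 + k * (2 * Real.pi * Complex.I) := by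
  have hfc : Continuous (fun t => f (c t)) := by
    rw [← continuousOn_univ]
    exact hf.comp h.continuous.continuousOn fun t _ => mem_range_self t
  obtain ⟨L, hL, he⟩ := hasContLog_of_continuous hfc fun t => h0 _ (mem_range_self t)
  have h1 : Complex.exp (L 1) = Complex.exp (L 0) := by
    simp only [he _ trivial]
    rw [← h.add_one 0, zero_add]
  obtain ⟨k, hk⟩ := Complex.exp_eq_exp_iff_exists_int.1 h1
  exact ⟨L, k, continuousOn_univ.1 hL, fun t => he t trivial, hk⟩

theorem hasContLog_of_closed (h : IsJordanParam c) {f : ℂ → ℂ} {L : ℝ → ℂ} (hL : Continuous L)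
    (he : ∀ t, Complex.exp (L t) = f (c t)) (h1 : L 1 = L 0) : HasContLog (range c) f := by
  have hinj := h.injOn_Ico 0
  rw [zero_add] at hinj
  obtain ⟨g, hg, hgc⟩ := exists_continuousOn_comp_eq (isCompact_Icc (a := (0 : ℝ)) (b := 1))
    h.continuous.continuousOn hL.continuousOn (by
      intro s hs t ht hst
      have h10 : c 1 = c 0 := by rw [← h.add_one 0, zero_add]
      rcases hs.2.eq_or_lt with rfl | hs1 <;> rcases ht.2.eq_or_lt with rfl | ht1
      · rfl
      · rw [h1, ← hinj ⟨le_rfl, one_pos⟩ ⟨ht.1, ht1⟩ (h10 ▸ hst)]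
      · rw [h1, hinj ⟨hs.1, hs1⟩ ⟨le_rfl, one_pos⟩ (h10 ▸ hst)]
      · rw [hinj ⟨hs.1, hs1⟩ ⟨ht.1, ht1⟩ hst])
  have him := h.image_Icc 0
  rw [zero_add] at him
  refine ⟨g, him ▸ hg, ?_⟩
  rw [← him]
  rintro _ ⟨t, ht, rfl⟩
  rw [hgc t ht, he]

/-- The complement of a simple closed curve has at most one bounded component. -/
theorem mem_connectedComponentIn_of_isBounded (h : IsJordanParam c) {x y : ℂ}
    (hx : x ∉ range c) (hy : y ∉ range c)
    (hbx : Bornology.IsBounded (connectedComponentIn (range c)ᶜ x))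
    (hby : Bornology.IsBounded (connectedComponentIn (range c)ᶜ y)) :
    y ∈ connectedComponentIn (range c)ᶜ x := by
  by_contra hyW
  have hcl := h.isCompact_range.isClosed
  have hfr := frontier_connectedComponentIn_subset hcl x
  have hsub : ∀ {x}, x ∉ range c → ∀ z ∈ range c, z - x ≠ 0 := fun hx z hz h0 =>
    hx (sub_eq_zero.1 h0 ▸ hz)
  obtain ⟨L, k, hL, heL, hk⟩ := h.exists_winding (f := fun z => z - x) (by fun_prop) (hsub hx)
  obtain ⟨M, l, hM, heM, hl⟩ := h.exists_winding (f := fun z => z - y) (by fun_prop) (hsub hy)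
  by_cases hl0 : l = 0
  · refine not_hasContLog_of_mem_bounded hcl hby
      (frontier_connectedComponentIn_subset hcl y) (mem_connectedComponentIn hy) one_ne_zero
      (q := fun _ => 1) continuousOn_const (by simp)
      ((h.hasContLog_of_closed (f := fun z => z - y) hM heM (by simpa [hl0] using hl)).congr
        (by simp))
  have hW := hcl.isOpen_compl.connectedComponentIn (x := x)
  have hycl : ∀ z ∈ closure (connectedComponentIn (range c)ᶜ x), z - y ≠ 0 := by
    intro z hz h0
    rw [sub_eq_zero] at h0
    subst h0
    exact hy (hfr (hW.frontier_eq ▸ ⟨hz, hyW⟩))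
  refine not_hasContLog_of_mem_bounded hcl hbx hfr (mem_connectedComponentIn hx)
    (n := l.natAbs) (by simpa using hl0) (q := fun z => (z - y) ^ (-l.sign * k))
    (ContinuousOn.zpow₀ (by fun_prop) _ fun z hz => Or.inl (hycl z hz))
    (fun z hz => zpow_ne_zero _ (hycl z hz))
    (h.hasContLog_of_closed (L := fun t => l.natAbs * L t + (-l.sign * k : ℤ) * M t)
      (by fun_prop) (fun t => ?_) ?_)
  · rw [Complex.exp_add, Complex.exp_nat_mul, heL, Complex.exp_int_mul, heM]
  · simp only [hk, hl]
    have : ((l.natAbs : ℤ) : ℂ) = (l.sign * l : ℤ) := by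
      rw [Int.sign_mul_self_eq_natAbs]
    rw [Int.cast_natCast] at this
    rw [this]
    push_cast
    ring

/-- A simple closed curve separates the plane. -/
theorem not_isPreconnected_compl (h : IsJordanParam c) : ¬ IsPreconnected (range c)ᶜ := by
  intro hcon
  set A := c '' Icc 0 (1 / 2) with hA
  set B := c '' Icc (1 / 2) 1 with hB
  have hAB : A ∪ B = range c := by
    rw [hA, hB, ← image_union, Icc_union_Icc_eq_Icc (by norm_num) (by norm_num),
      ← h.image_Icc 0, zero_add]
  have h10 : c 1 = c 0 := by rw [← h.add_one 0, zero_add]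
  have hpq : c 0 ≠ c (1 / 2) := fun he => by
    have := h.eq_of_mem_Ico (a := 0) (s := 0) (t := 1 / 2) (by norm_num) (by norm_num) he
    norm_num at this
  have hAc : IsCompact A := isCompact_Icc.image h.continuous
  have hBc : IsCompact B := isCompact_Icc.image h.continuous
  have hlog : ∀ {a b : ℝ}, a ≤ b → HasContLog (c '' Icc a b)ᶜ (fun z => (z - c a) / (z - c b)) := by
    intro a b hab
    have hp : IsPathConnected (c '' Icc a b) :=
      ((convex_Icc a b).isPathConnected (nonempty_Icc.2 hab)).image h.continuous
    apply JoinedIn.hasContLog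
    rw [compl_compl]
    exact hp.joinedIn _ ⟨a, ⟨le_rfl, hab⟩, rfl⟩ _ ⟨b, ⟨hab, le_rfl⟩, rfl⟩
  have h1 : HasContLog Aᶜ (fun z => (z - c 0) / (z - c (1 / 2))) := hlog (by norm_num)
  have h2 : HasContLog Bᶜ (fun z => (z - c 0) / (z - c (1 / 2))) :=
    (hlog (a := 1 / 2) (b := 1) (by norm_num)).inv.congr fun z _ => by rw [inv_div, h10]
  have h3 := h1.union_of_isOpen h2 (by rwa [← compl_union, hAB]) hAc.isClosed.isOpen_compl
    hBc.isClosed.isOpen_compl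
  have hinter : A ∩ B ⊆ {c 0, c (1 / 2)} := by
    rintro _ ⟨⟨s, hs, rfl⟩, t, ht, hst⟩
    rcases ht.2.eq_or_lt with rfl | ht1
    · exact Or.inl (by rw [← hst, h10])
    · have := h.eq_of_mem_Ico (a := 0) (s := t) (t := s) ⟨by linarith [ht.1], by linarith⟩
        ⟨hs.1, by linarith [hs.2]⟩ hst
      have : s = 1 / 2 := le_antisymm hs.2 (this ▸ ht.1)
      exact Or.inr (by rw [this]; rfl)
  have hd : 0 < dist (c 0) (c (1 / 2)) := dist_pos.2 hpq
  set R := dist (c 0) (c (1 / 2)) / 2 with hR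
  have hRd : R < dist (c 0) (c (1 / 2)) := by linarith
  have hne : ∀ z ∈ closedBall (c 0) R, z ≠ c (1 / 2) := by
    rintro z hz rfl
    rw [mem_closedBall, dist_comm] at hz
    linarith
  have h4 : HasContLog (closedBall (c 0) R) (fun z => z - c (1 / 2)) := by
    refine ((hasContLog_of_re_pos (f := fun z => (z - c (1 / 2)) / (c 0 - c (1 / 2)))
      (by fun_prop) fun z hz => ?_).mul (hasContLog_const _ (sub_ne_zero.2 hpq))).congr
        fun z _ => div_mul_cancel₀ _ (sub_ne_zero.2 hpq)
    have : (z - c (1 / 2)) / (c 0 - c (1 / 2)) = 1 + (z - c 0) / (c 0 - c (1 / 2)) := by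
      field_simp [sub_ne_zero.2 hpq]
      ring
    rw [this, Complex.add_re, Complex.one_re]
    have h5 : ‖(z - c 0) / (c 0 - c (1 / 2))‖ ≤ 1 / 2 := by
      rw [norm_div, ← dist_eq_norm, ← dist_eq_norm, div_le_iff₀ hd]
      rw [mem_closedBall] at hz
      linarith
    linarith [neg_le_of_abs_le ((Complex.abs_re_le_norm _).trans h5)]
  refine not_hasContLog_sphere_pow (x := c 0) (R := R) (by positivity) one_ne_zero
    (((h3.mono ?_).mul (h4.mono sphere_subset_closedBall)).congr fun z hz => ?_)
  · intro z hz
    rw [← compl_inter]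
    intro hzi
    rcases hinter hzi with rfl | rfl
    · rw [mem_sphere, dist_self] at hz
      linarith
    · exact hne _ (sphere_subset_closedBall hz) rfl
  · rw [pow_one, div_mul_cancel₀ _ (sub_ne_zero.2 (hne z (sphere_subset_closedBall hz)))]

/-- Every point of a simple closed curve is on the boundary of every complementary component. -/
theorem frontier_connectedComponentIn (h : IsJordanParam c) {x : ℂ} (hx : x ∉ range c) :
    frontier (connectedComponentIn (range c)ᶜ x) = range c := by
  have hcl := h.isCompact_range.isClosed
  have hfr := frontier_connectedComponentIn_subset hcl x
  refine hfr.antisymm ?_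
  rintro _ ⟨t, rfl⟩
  by_contra ht
  obtain ⟨ε, hε, hball⟩ := Metric.isOpen_iff.1 isClosed_frontier.isOpen_compl (c t) ht
  obtain ⟨a, b, hab, -, hsub⟩ := h.exists_arc_of_notMem_ball t hε
  set W := connectedComponentIn (range c)ᶜ x with hW
  have hWo : IsOpen W := hcl.isOpen_compl.connectedComponentIn
  have hfrA : frontier W ⊆ c '' Icc a b := fun z hz =>
    hsub ⟨hfr hz, fun hzb => hball hzb hz⟩
  have hxW : x ∈ W := mem_connectedComponentIn hx
  refine h.not_isPreconnected_compl (?_ : IsPreconnected (range c)ᶜ)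
  convert! isPreconnected_connectedComponentIn (F := (range c)ᶜ) (x := x) using 1
  refine (connectedComponentIn_subset _ _).antisymm' fun y hy => ?_
  by_contra hyW
  have hnA : ∀ z, z ∉ range c → z ∉ c '' Icc a b := fun z hz hzA => hz (image_subset_range _ _ hzA)
  obtain ⟨α, hα⟩ := joinedIn_compl_image_Icc h.continuous.continuousOn (h.injOn_Icc hab)
    (hnA x hx) (hnA y hy)
  have hpre : IsPreconnected (range α) := isPreconnected_range α.continuous
  have := (hpre.subset_of_closure_inter_subset hWo ⟨x, ⟨0, by simp⟩, hxW⟩ ?_)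
    (show y ∈ range α from ⟨1, by simp⟩)
  · exact hyW this
  · rintro z ⟨hzW, s, rfl⟩
    by_contra hz
    exact hα s (hfrA (hWo.frontier_eq ▸ ⟨hzW, hz⟩))

end IsJordanParam

end Curves

section SimplyConnected

theorem isPreconnected_of_forall_joinedIn {X : Type*} [TopologicalSpace X] {S : Set X}
    (h : ∀ x ∈ S, ∀ y ∈ S, JoinedIn S x y) : IsPreconnected S :=
  isPreconnected_of_forall_pair fun x hx y hy =>
    let ⟨α, hα⟩ := h x hx y hy
    ⟨range α, range_subset_iff.2 hα, ⟨0, α.source⟩, ⟨1, α.target⟩,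
      isPreconnected_range α.continuous⟩

theorem IsJordanParam.isPreconnected_compl_connectedComponentIn {c : ℝ → ℂ}
    (h : IsJordanParam c) (x : ℂ) :
    IsPreconnected (connectedComponentIn (range c)ᶜ x)ᶜ := by
  have hcl := h.isCompact_range.isClosed
  have hsub : range c ⊆ (connectedComponentIn (range c)ᶜ x)ᶜ := fun z hz hzU =>
    connectedComponentIn_subset _ _ hzU hz
  refine isPreconnected_of_forall (c 0) fun z hz => ?_
  by_cases hzc : z ∈ range c
  · exact ⟨range c, hsub, mem_range_self 0, hzc, isPreconnected_range h.continuous⟩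
  · refine ⟨closure (connectedComponentIn (range c)ᶜ z), fun w hw hwU => ?_, ?_,
      subset_closure (mem_connectedComponentIn hzc), isPreconnected_connectedComponentIn.closure⟩
    · obtain ⟨v, hvU, hvz⟩ := mem_closure_iff.1 hw _ hcl.isOpen_compl.connectedComponentIn hwU
      apply hz
      rw [connectedComponentIn_eq hvU, ← connectedComponentIn_eq hvz]
      exact mem_connectedComponentIn hzc
    · apply frontier_subset_closure
      rw [h.frontier_connectedComponentIn hzc]
      exact mem_range_self 0

/-- A bounded plane domain with connected complement has only one end. -/
theorem exists_isCompact_isPreconnected_diff {U K : Set ℂ} (hU : IsOpen U)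
    (hUb : Bornology.IsBounded U) (hUc : IsPreconnected U) (hUc' : IsPreconnected Uᶜ)
    (hK : IsCompact K) (hKU : K ⊆ U) :
    ∃ K', IsCompact K' ∧ K ⊆ K' ∧ K' ⊆ U ∧ IsPreconnected (U \ K') := by
  obtain ⟨R, hR⟩ := hUb.subset_closedBall 0
  obtain ⟨w, hw⟩ : ∃ w, w ∉ U := by
    by_contra! hcon
    exact NormedSpace.unbounded_univ ℂ ℂ (eq_univ_of_forall hcon ▸ hUb)
  have hUK : Uᶜ ⊆ Kᶜ := compl_subset_compl.2 hKU
  set N := connectedComponentIn Kᶜ w with hN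
  have hNo : IsOpen N := hK.isClosed.isOpen_compl.connectedComponentIn
  have hUN : Uᶜ ⊆ N := hUc'.subset_connectedComponentIn hw hUK
  have hNU : Nᶜ ⊆ U := compl_subset_comm.1 hUN
  have hNc : IsCompact Nᶜ := isCompact_of_isClosed_isBounded hNo.isClosed_compl (hUb.subset hNU)
  refine ⟨Nᶜ, hNc, subset_compl_comm.1 (connectedComponentIn_subset _ _), hNU, ?_⟩
  refine isPreconnected_of_forall_joinedIn fun x hx y hy => ?_
  have hCc : IsCompact (closedBall 0 R \ U) := (isCompact_closedBall 0 R).diff hU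
  have h1 : JoinedIn (closedBall 0 R \ U)ᶜ x y :=
    hUc.joinedIn_compl hCc.isClosed disjoint_sdiff_right hx.1 hy.1
  have h2 : JoinedIn Nᶜᶜ x y := isPreconnected_connectedComponentIn.joinedIn_compl
    hNc.isClosed disjoint_compl_right (not_not.1 hx.2) (not_not.1 hy.2)
  obtain ⟨α, hα⟩ := h1.janiszewski hCc hNc (by
    rw [(disjoint_sdiff_left.mono_right hNU).inter_eq]
    exact isPreconnected_empty) h2
  have hαU : range α ⊆ U := by
    refine (isPreconnected_range α.continuous).subset_left_of_subset_union hU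
      (isClosed_closedBall (x := (0 : ℂ)) (ε := R)).isOpen_compl
      (disjoint_compl_right.mono_left hR) ?_ ⟨x, ⟨0, α.source⟩, hx.1⟩
    rintro _ ⟨t, rfl⟩
    by_cases ht : α t ∈ U
    · exact Or.inl ht
    · exact Or.inr fun hb => hα t (Or.inl ⟨hb, ht⟩)
  exact ⟨α, fun t => ⟨hαU ⟨t, rfl⟩, fun ht => hα t (Or.inr ht)⟩⟩

/-- A homeomorphic image in the plane of a bounded one-ended domain does not wind around the points
it omits. -/
theorem hasContLog_sub_of_injOn {U K : Set ℂ} (hU : IsOpen U)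
    (hUb : Bornology.IsBounded U) (hUc : IsPreconnected U) (hUc' : IsPreconnected Uᶜ)
    (hK : IsCompact K) (hKU : K ⊆ U) {f : ℂ → ℂ} (hf : ContinuousOn f U) (hinj : InjOn f U)
    (hfo : IsOpen (f '' U)) {a : ℂ} (ha : a ∉ f '' U) : HasContLog K (fun z => f z - a) := by
  obtain ⟨K', hK', hKK', hK'U, hpre⟩ :=
    exists_isCompact_isPreconnected_diff hU hUb hUc hUc' hK hKU
  rcases K'.eq_empty_or_nonempty with rfl | ⟨z₀, hz₀⟩
  · rw [subset_empty_iff.1 hKK']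
    exact ⟨0, continuousOn_empty _, by simp⟩
  have hfK : IsCompact (f '' K') := hK'.image_of_continuousOn (hf.mono hK'U)
  obtain ⟨R, hR⟩ := hfK.isBounded.subset_closedBall 0
  have hR0 : 0 ≤ R := nonempty_closedBall.1 ⟨_, hR (mem_image_of_mem f hz₀)⟩
  have hb : ((R + 1 : ℝ) : ℂ) ∉ f '' K' := fun h => by
    have := hR h
    rw [mem_closedBall_zero_iff, Complex.norm_real, Real.norm_eq_abs, abs_of_pos (by linarith)]
      at this
    linarith
  set b : ℂ := ((R + 1 : ℝ) : ℂ) with hbdef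
  have haK : a ∉ f '' K' := fun h => ha (image_mono hK'U h)
  have hmeet : ∀ {x y}, x ∉ f '' K' → y ∉ connectedComponentIn (f '' K')ᶜ x →
      ∃ w ∈ f '' (U \ K'), w ∈ connectedComponentIn (f '' K')ᶜ x := by
    intro x y hx hy
    obtain ⟨p, hp⟩ := nonempty_frontier_iff.2
      ⟨⟨x, mem_connectedComponentIn hx⟩, (ne_univ_iff_exists_notMem _).2 ⟨y, hy⟩⟩
    have hpU : p ∈ f '' U :=
      image_mono hK'U (frontier_connectedComponentIn_subset hfK.isClosed x hp)
    obtain ⟨_, ⟨v, hv, rfl⟩, hvx⟩ :=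
      mem_closure_iff.1 (frontier_subset_closure hp) _ hfo hpU
    exact ⟨f v, ⟨v, ⟨hv, fun hvK => connectedComponentIn_subset _ _ hvx ⟨v, hvK, rfl⟩⟩, rfl⟩, hvx⟩
  have hab : JoinedIn (f '' K')ᶜ a b := by
    by_contra hj
    have h1 : b ∉ connectedComponentIn (f '' K')ᶜ a := fun h =>
      hj (joinedIn_of_mem_connectedComponentIn hfK.isClosed h)
    have h2 : a ∉ connectedComponentIn (f '' K')ᶜ b := fun h =>
      hj (joinedIn_of_mem_connectedComponentIn hfK.isClosed h).symm
    obtain ⟨u, hu, hua⟩ := hmeet haK h1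
    obtain ⟨v, hv, hvb⟩ := hmeet hb h2
    have huv : JoinedIn (f '' K')ᶜ u v := by
      refine (hpre.image f (hf.mono sdiff_subset)).joinedIn_compl hfK.isClosed ?_ hu hv
      rw [disjoint_left]
      rintro _ ⟨s, hs, rfl⟩ ⟨t, ht, hst⟩
      exact hs.2 (hinj (hK'U ht) hs.1 hst ▸ ht)
    exact hj (((joinedIn_of_mem_connectedComponentIn hfK.isClosed hua).trans huv).trans
      (joinedIn_of_mem_connectedComponentIn hfK.isClosed hvb).symm)
  have hblog : HasContLog (f '' K') (fun z => z - b) := by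
    have hb0 : b ≠ 0 := by
      rw [hbdef, Ne, Complex.ofReal_eq_zero]
      positivity
    refine ((hasContLog_of_re_pos (f := fun z => 1 - z / b) (by fun_prop) fun z hz => ?_).mul
      (hasContLog_const _ (neg_ne_zero.2 hb0))).congr fun z _ => by field_simp; ring
    have h1 : ‖z / b‖ < 1 := by
      rw [norm_div, div_lt_one (norm_pos_iff.2 hb0), hbdef, Complex.norm_real, Real.norm_eq_abs,
        abs_of_pos (by linarith)]
      have := hR hz
      rw [mem_closedBall_zero_iff] at this
      linarith
    rw [Complex.sub_re, Complex.one_re]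
    linarith [(le_abs_self _).trans_lt ((Complex.abs_re_le_norm _).trans_lt h1)]
  exact ((hab.hasContLog.mul hblog).congr fun z hz => div_mul_cancel₀ _ (sub_ne_zero.2
    (by rintro rfl; exact hb hz))).comp (hf.mono (hKK'.trans hK'U))
      fun z hz => mem_image_of_mem f (hKK' hz)

/-- Logarithms on all compact subsets of a plane domain give a logarithm on the domain. -/
theorem hasContLog_of_forall_isCompact {U : Set ℂ} (hU : IsOpen U) (hUc : IsPreconnected U)
    {f : ℂ → ℂ} (hf : ContinuousOn f U)
    (h : ∀ K ⊆ U, IsCompact K → HasContLog K f) : HasContLog U f := by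
  rcases U.eq_empty_or_nonempty with rfl | ⟨a, ha⟩
  · exact ⟨0, continuousOn_empty _, by simp⟩
  have h0 : ∀ z ∈ U, f z ≠ 0 := fun z hz => by
    obtain ⟨g, -, hg⟩ := h {z} (singleton_subset_iff.2 hz) isCompact_singleton
    rw [← hg z rfl]
    exact Complex.exp_ne_zero _
  have hUp : IsPathConnected U := (hU.isConnected_iff_isPathConnected).1 ⟨⟨a, ha⟩, hUc⟩
  have : PathConnectedSpace U := isPathConnected_iff_pathConnectedSpace.1 hUp
  have : LocallyPathConnectedSpace U := hU.locallyPathConnectedSpace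
  let F : C(U, {z : ℂ // z ≠ 0}) := ⟨fun z => ⟨f z, h0 z z.2⟩,
    (continuousOn_iff_continuous_domRestrict.1 hf).subtype_mk _⟩
  have cov := Complex.isCoveringMap_exp
  have he : (⟨Complex.exp (Complex.log (f a)), Complex.exp_ne_zero _⟩ : {z : ℂ // z ≠ 0}) =
      F ⟨a, ha⟩ := Subtype.ext (Complex.exp_log (h0 a ha))
  obtain ⟨G, ⟨-, hG⟩, -⟩ := cov.isLocalHomeomorph.existsUnique_continuousMap_lifts
    F ⟨a, ha⟩ (Complex.log (f a)) he
    (fun γ hγ => by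
      obtain ⟨Γ, h1, h2⟩ := cov.exists_path_lifts (F.comp γ) (Complex.log (f a))
        (by rw [he, ← hγ]; rfl)
      exact ⟨Γ, h2, h1⟩) (by
    intro γ γ' Γ Γ' h1 h1' h2 h2' h3 h3' h4
    obtain ⟨L, hL, hLe⟩ := h ((fun t => (γ t : ℂ)) '' univ ∪ (fun t => (γ' t : ℂ)) '' univ)
      (by rintro _ (⟨t, -, rfl⟩ | ⟨t, -, rfl⟩) <;> exact Subtype.coe_prop _)
      ((isCompact_univ.image (by fun_prop)).union (isCompact_univ.image (by fun_prop)))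
    have key : ∀ (γ : C(unitInterval, U)) (Γ : C(unitInterval, ℂ)), γ 0 = ⟨a, ha⟩ →
        Γ 0 = Complex.log (f a) → (fun z : ℂ => (⟨Complex.exp z, Complex.exp_ne_zero z⟩ :
          {z : ℂ // z ≠ 0})) ∘ Γ = F.comp γ → ContinuousOn L ((fun t => (γ t : ℂ)) '' univ) →
        (∀ z ∈ (fun t => (γ t : ℂ)) '' univ, Complex.exp (L z) = f z) →
        Γ 1 = L (γ 1) + (Complex.log (f a) - L a) := by
      intro γ Γ h1 h2 h3 hL hLe
      obtain ⟨k, -, hk⟩ := exists_eqOn_add_const_of_exp_eq (S := (univ : Set unitInterval))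
        isPreconnected_univ (g₁ := Γ) (g₂ := fun t => L (γ t)) (by fun_prop)
        (hL.comp (by fun_prop) (mapsTo_image _ _)) (fun t _ => by
          rw [hLe _ ⟨t, trivial, rfl⟩]
          exact congr_arg Subtype.val (congr_fun h3 t))
      rw [hk 1 trivial, ← h2, hk 0 trivial, h1]
      ring
    rw [key γ Γ h1 h2 h3 (hL.mono subset_union_left) fun z hz => hLe z (Or.inl hz),
      key γ' Γ' h1' h2' h3' (hL.mono subset_union_right) fun z hz => hLe z (Or.inr hz), h4])
  classical
  refine ⟨fun z => if hz : z ∈ U then G ⟨z, hz⟩ else 0, ?_, fun z hz => ?_⟩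
  · rw [continuousOn_iff_continuous_domRestrict]
    convert! G.continuous using 1
    ext z
    simp
  · have := congr_arg Subtype.val (congr_fun hG ⟨z, hz⟩)
    simp only [dif_pos hz]
    exact this

/-- An injective holomorphic function on a domain is open. -/
theorem isOpen_image_of_differentiableOn_injOn {U V : Set ℂ} {f : ℂ → ℂ}
    (hf : DifferentiableOn ℂ f U) (hinj : InjOn f U) (hV : IsOpen V) (hVU : V ⊆ U) :
    IsOpen (f '' V) := by
  rw [isOpen_iff_mem_nhds]
  rintro _ ⟨z, hz, rfl⟩
  obtain ⟨r, hr, hball⟩ := Metric.isOpen_iff.1 hV z hz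
  have han : AnalyticOnNhd ℂ f (ball z r) :=
    (hf.mono (hball.trans hVU)).analyticOnNhd isOpen_ball
  rcases han.is_constant_or_isOpen (convex_ball z r).isPreconnected with ⟨w, hw⟩ | ho
  · have hz2 : z + (r / 2 : ℝ) ∈ ball z r := by
      rw [mem_ball, dist_eq_norm, add_sub_cancel_left, Complex.norm_real, Real.norm_eq_abs,
        abs_of_pos (by positivity)]
      linarith
    have := hinj (hVU (hball hz2)) (hVU hz) (by rw [hw _ hz2, hw _ (mem_ball_self hr)])
    simp [hr.ne'] at this
  · exact Filter.mem_of_superset ((ho _ subset_rfl isOpen_ball).mem_nhds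
      ⟨z, mem_ball_self hr, rfl⟩) (image_mono hball)

/-- A continuous square root of a nonvanishing differentiable function is differentiable. -/
theorem differentiableAt_of_sq_eq {s g : ℂ → ℂ} {a : ℂ} (hs : ContinuousAt s a)
    (hg : DifferentiableAt ℂ g a) (h : ∀ᶠ z in nhds a, s z ^ 2 = g z) (h0 : g a ≠ 0) :
    DifferentiableAt ℂ s a := by
  have hsa : s a ≠ 0 := fun h1 => h0 (by rw [← h.self_of_nhds, h1]; simp)
  have hne : ∀ᶠ z in nhds a, s z + s a ≠ 0 :=
    (hs.add continuousAt_const).eventually_ne (by simpa [← two_mul] using hsa)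
  have ht := (hasDerivAt_iff_tendsto_slope.1 hg.hasDerivAt).mul
    ((hs.add continuousAt_const).inv₀ hne.self_of_nhds).continuousWithinAt.tendsto
  refine HasDerivAt.differentiableAt (f' := _) (hasDerivAt_iff_tendsto_slope.2 (ht.congr' ?_))
  filter_upwards [(h.and hne).filter_mono nhdsWithin_le_nhds] with z hz
  rw [slope_def_field, slope_def_field, ← hz.1, ← h.self_of_nhds]
  have := hz.2
  simp only [Pi.inv_apply, Pi.add_apply]
  field_simp
  ring

/-- Injective holomorphic nonvanishing functions on a bounded plane domain with connected complement
have holomorphic square roots. -/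
theorem exists_sq_eq_of_injOn {U : Set ℂ} (hU : IsOpen U)
    (hUb : Bornology.IsBounded U) (hUc : IsPreconnected U) (hUc' : IsPreconnected Uᶜ)
    {f : ℂ → ℂ} (hf : DifferentiableOn ℂ f U) (hinj : InjOn f U) (h0 : ∀ z ∈ U, f z ≠ 0) :
    ∃ s : ℂ → ℂ, DifferentiableOn ℂ s U ∧ ∀ z ∈ U, s z ^ 2 = f z := by
  obtain ⟨L, hL, he⟩ := hasContLog_of_forall_isCompact hU hUc hf.continuousOn fun K hKU hK => by
    simpa using hasContLog_sub_of_injOn hU hUb hUc hUc' hK hKU hf.continuousOn hinj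
      (isOpen_image_of_differentiableOn_injOn hf hinj hU subset_rfl) (a := 0)
      (fun ⟨z, hz, hz0⟩ => h0 z hz hz0)
  have hsq : ∀ z ∈ U, Complex.exp (L z / 2) ^ 2 = f z := fun z hz => by
    rw [← he z hz, ← Complex.exp_nat_mul]
    congr 1
    push_cast
    ring
  refine ⟨fun z => Complex.exp (L z / 2), fun z hz => ?_, hsq⟩
  have hUz := hU.mem_nhds hz
  refine (differentiableAt_of_sq_eq ?_ (hf.differentiableAt hUz)
    (Filter.eventually_of_mem hUz hsq) (h0 z hz)).differentiableWithinAt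
  exact ((hL.continuousAt hUz).div_const 2).cexp

end SimplyConnected

section RiemannMapping

theorem exists_tendstoLocallyUniformlyOn_of_mapsTo_ball {ι : Type*} (l : Ultrafilter ι)
    {f : ι → ℂ → ℂ} {U : Set ℂ} (hU : IsOpen U) (hd : ∀ i, DifferentiableOn ℂ (f i) U)
    (hm : ∀ i, MapsTo (f i) U (ball 0 1)) :
    ∃ g, TendstoLocallyUniformlyOn f g l U ∧ MapsTo g U (closedBall 0 1) := by
  have hlim : ∀ z, ∃ w, z ∈ U → w ∈ closedBall (0 : ℂ) 1 ∧
      Filter.Tendsto (fun i => f i z) l (nhds w) := by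
    intro z
    by_cases hz : z ∈ U
    · obtain ⟨w, hw, hlw⟩ := (isCompact_closedBall (0 : ℂ) 1).ultrafilter_le_nhds
        (l.map fun i => f i z) (Filter.le_principal_iff.2 (Filter.eventually_map.2
          (Filter.Eventually.of_forall fun i => ball_subset_closedBall (hm i hz))))
      exact ⟨w, fun _ => ⟨hw, hlw⟩⟩
    · exact ⟨0, fun h => absurd h hz⟩
  choose g hg using hlim
  refine ⟨g, ?_, fun z hz => (hg z hz).1⟩
  rw [Metric.tendstoLocallyUniformlyOn_iff]
  intro ε hε x hx
  obtain ⟨r, hr, hball⟩ := Metric.isOpen_iff.1 hU x hx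
  have hlip : ∀ i, ∀ y ∈ ball x r, dist (f i y) (f i x) ≤ 2 / r * dist y x := fun i y hy => by
    refine Complex.dist_le_div_mul_dist_of_mapsTo_ball ((hd i).mono hball) (fun w hw => ?_) hy
    have h1 := mem_ball.1 (hm i (hball hw))
    have h2 := mem_ball.1 (hm i hx)
    rw [mem_closedBall]
    linarith [dist_triangle_right (f i w) (f i x) 0]
  have hlip' : ∀ y ∈ ball x r, dist (g y) (g x) ≤ 2 / r * dist y x := fun y hy =>
    le_of_tendsto ((hg y (hball hy)).2.dist (hg x hx).2)
      (Filter.Eventually.of_forall fun i => hlip i y hy)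
  refine ⟨ball x (min r (r * ε / 6)), nhdsWithin_le_nhds (ball_mem_nhds _ (by positivity)), ?_⟩
  filter_upwards [(Metric.tendsto_nhds.1 (hg x hx).2 (ε / 3) (by positivity))] with i hi y hy
  have hyr : y ∈ ball x r := ball_subset_ball (min_le_left _ _) hy
  have hye : 2 / r * dist y x < ε / 3 := by
    have : dist y x < r * ε / 6 := (mem_ball.1 hy).trans_le (min_le_right _ _)
    calc 2 / r * dist y x < 2 / r * (r * ε / 6) := by gcongr
      _ = ε / 3 := by field_simp; norm_num
  have h1 := hlip i y hyr
  have h2 := hlip' y hyr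
  rw [dist_comm] at hi h1
  linarith [dist_triangle4 (g y) (g x) (f i x) (f i y)]

theorem TendstoLocallyUniformlyOn.injOn {ι : Type*} {l : Filter ι} [l.NeBot] {f : ι → ℂ → ℂ}
    {g : ℂ → ℂ} {U : Set ℂ} (h : TendstoLocallyUniformlyOn f g l U) (hU : IsOpen U)
    (hUc : IsPreconnected U) (hd : ∀ i, DifferentiableOn ℂ (f i) U) (hinj : ∀ i, InjOn (f i) U)
    (hg : ∃ z ∈ U, ∃ w ∈ U, g z ≠ g w) : InjOn g U := by
  intro a ha b hb hab
  by_contra hne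
  have hgd : DifferentiableOn ℂ g U := h.differentiableOn (Filter.Eventually.of_forall hd) hU
  have hgan := hgd.analyticOnNhd hU
  have hiso : ∀ᶠ z in nhdsWithin a {a}ᶜ, g z ≠ g b := by
    by_contra hcon
    have hconst := hgan.eqOn_of_preconnected_of_frequently_eq (g := fun _ => g b)
      analyticOnNhd_const hUc ha hcon
    obtain ⟨z, hz, w, hw, hzw⟩ := hg
    exact hzw ((hconst hz).trans (hconst hw).symm)
  rw [eventually_nhdsWithin_iff] at hiso
  obtain ⟨r, hr, hball⟩ := Metric.nhds_basis_closedBall.mem_iff.1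
    (Filter.inter_mem hiso (Filter.inter_mem (hU.mem_nhds ha)
      (isOpen_compl_singleton.mem_nhds hne : {b}ᶜ ∈ nhds a)))
  have hsU : closedBall a r ⊆ U := fun z hz => (hball hz).2.1
  obtain ⟨v, hv, hmin⟩ := (isCompact_sphere a r).exists_isMinOn
    (NormedSpace.sphere_nonempty.2 hr.le) (f := fun z => ‖g z - g b‖)
    (((hgd.continuousOn.mono (sphere_subset_closedBall.trans hsU)).sub continuousOn_const).norm)
  set m := ‖g v - g b‖
  have hm : 0 < m := by
    refine norm_pos_iff.2 (sub_ne_zero.2 ((hball (sphere_subset_closedBall hv)).1 ?_))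
    rintro rfl
    simp [hr.ne] at hv
  have hunif := (tendstoLocallyUniformlyOn_iff_forall_isCompact hU).1 h _
    (insert_subset hb hsU) ((isCompact_closedBall a r).insert b)
  obtain ⟨n, hn⟩ := (Metric.tendstoUniformlyOn_iff.1 hunif (m / 8) (by positivity)).exists
  have hF0 : ∀ z ∈ closedBall a r, f n z - f n b ≠ 0 := fun z hz h0 =>
    (hball hz).2.2 (hinj n (hsU hz) hb (sub_eq_zero.1 h0))
  have hcl : closure (ball a r) = closedBall a r := closure_ball a hr.ne'
  have hDC : DiffContOnCl ℂ (fun z => (f n z - f n b)⁻¹) (ball a r) := by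
    refine DifferentiableOn.diffContOnCl ?_
    rw [hcl]
    exact ((((hd n).mono hsU).sub_const _).inv hF0)
  have hmax := Complex.norm_le_of_forall_mem_frontier_norm_le isBounded_ball hDC
    (C := (3 * m / 4)⁻¹) (fun z hz => ?_) (subset_closure (mem_ball_self hr))
  · have ha' : ‖f n a - f n b‖ ≤ m / 4 := by
      have h1 := hn a (mem_insert_of_mem _ (mem_closedBall_self hr.le))
      have h2 := hn b (mem_insert _ _)
      rw [hab] at h1
      rw [← dist_eq_norm]
      linarith [dist_triangle_left (f n a) (f n b) (g b)]
    rw [norm_inv] at hmax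
    have hpos : 0 < ‖f n a - f n b‖ := norm_pos_iff.2 (hF0 a (mem_closedBall_self hr.le))
    have := (inv_le_inv₀ hpos (by positivity)).1 hmax
    linarith
  · rw [frontier_ball a hr.ne'] at hz
    rw [norm_inv]
    refine inv_anti₀ (by positivity) ?_
    have h1 := hn z (mem_insert_of_mem _ (sphere_subset_closedBall hz))
    have h2 := hn b (mem_insert _ _)
    have h3 : m ≤ dist (g z) (g b) := by rw [dist_eq_norm]; exact hmin hz
    rw [← dist_eq_norm]
    rw [dist_comm] at h2
    linarith [dist_triangle4 (g z) (f n z) (f n b) (g b)]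

/-- The disc automorphism sending `a` to `0`. -/
noncomputable def discShift (a w : ℂ) : ℂ := (w - a) / (1 - starRingEnd ℂ a * w)

theorem one_sub_conj_mul_ne_zero {a w : ℂ} (ha : ‖a‖ < 1) (hw : ‖w‖ < 1) :
    1 - starRingEnd ℂ a * w ≠ 0 := by
  intro h
  have h1 : ‖starRingEnd ℂ a * w‖ = 1 := by rw [← sub_eq_zero.1 h, norm_one]
  rw [norm_mul, RCLike.norm_conj] at h1
  nlinarith [norm_nonneg a, norm_nonneg w]

theorem norm_discShift_lt_one {a w : ℂ} (ha : ‖a‖ < 1) (hw : ‖w‖ < 1) : ‖discShift a w‖ < 1 := by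
  have hne := one_sub_conj_mul_ne_zero ha hw
  rw [discShift, norm_div, div_lt_one (norm_pos_iff.2 hne)]
  refine lt_of_pow_lt_pow_left₀ 2 (norm_nonneg _) ?_
  have key : ‖1 - starRingEnd ℂ a * w‖ ^ 2 - ‖w - a‖ ^ 2 = (1 - ‖a‖ ^ 2) * (1 - ‖w‖ ^ 2) := by
    simp only [Complex.sq_norm, Complex.normSq_apply, Complex.sub_re, Complex.sub_im,
      Complex.mul_re, Complex.mul_im, Complex.conj_re, Complex.conj_im, Complex.one_re,
      Complex.one_im]
    ring
  have : 0 < (1 - ‖a‖ ^ 2) * (1 - ‖w‖ ^ 2) := by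
    have := norm_nonneg a
    have := norm_nonneg w
    apply mul_pos <;> nlinarith
  linarith

theorem differentiableOn_discShift {a : ℂ} (ha : ‖a‖ < 1) :
    DifferentiableOn ℂ (discShift a) (ball 0 1) :=
  (differentiableOn_id.sub_const a).div
    ((differentiableOn_const 1).sub (differentiableOn_id.const_mul _))
    fun _ hw => one_sub_conj_mul_ne_zero ha (mem_ball_zero_iff.1 hw)

theorem injOn_discShift {a : ℂ} (ha : ‖a‖ < 1) : InjOn (discShift a) (ball 0 1) := by
  intro z hz w hw h
  rw [mem_ball_zero_iff] at hz hw
  rw [discShift, discShift, div_eq_div_iff (one_sub_conj_mul_ne_zero ha hz)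
    (one_sub_conj_mul_ne_zero ha hw)] at h
  have h1 : (z - w) * (1 - starRingEnd ℂ a * a) = 0 := by linear_combination h
  exact sub_eq_zero.1 ((mul_eq_zero.1 h1).resolve_right (one_sub_conj_mul_ne_zero ha ha))

/-- Koebe's square root trick. -/
theorem exists_norm_lt_of_notMem_image {U : Set ℂ}
    (hsq : ∀ f : ℂ → ℂ, DifferentiableOn ℂ f U → InjOn f U → (∀ z ∈ U, f z ≠ 0) →
      ∃ s, DifferentiableOn ℂ s U ∧ ∀ z ∈ U, s z ^ 2 = f z)
    {f : ℂ → ℂ} (hf : DifferentiableOn ℂ f U) (hinj : InjOn f U) (hm : MapsTo f U (ball 0 1))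
    {z₀ z₁ a : ℂ} (hz₀ : z₀ ∈ U) (hz₁ : z₁ ∈ U) (hne : z₁ ≠ z₀) (hf0 : f z₀ = 0)
    (ha : a ∈ ball (0 : ℂ) 1) (haU : a ∉ f '' U) :
    ∃ g : ℂ → ℂ, DifferentiableOn ℂ g U ∧ InjOn g U ∧ MapsTo g U (ball 0 1) ∧ g z₀ = 0 ∧
      ‖f z₁‖ < ‖g z₁‖ := by
  have ha1 := mem_ball_zero_iff.1 ha
  have hfn : ∀ z ∈ U, ‖f z‖ < 1 := fun z hz => mem_ball_zero_iff.1 (hm hz)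
  obtain ⟨s, hsd, hs⟩ := hsq (fun z => discShift a (f z))
    ((differentiableOn_discShift ha1).comp hf hm)
    ((injOn_discShift ha1).comp hinj hm) (fun z hz h0 => haU ⟨z, hz, by
      rw [discShift, div_eq_zero_iff] at h0
      exact sub_eq_zero.1 (h0.resolve_right (one_sub_conj_mul_ne_zero ha1 (hfn z hz)))⟩)
  have hs1 : ∀ z ∈ U, ‖s z‖ < 1 := fun z hz => by
    have h1 : ‖s z ^ 2‖ < 1 := by rw [hs z hz]; exact norm_discShift_lt_one ha1 (hfn z hz)
    rw [norm_pow] at h1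
    exact lt_of_pow_lt_pow_left₀ 2 zero_le_one (by simpa using h1)
  have hsm : MapsTo s U (ball 0 1) := fun z hz => mem_ball_zero_iff.2 (hs1 z hz)
  have hsi : InjOn s U := fun z hz w hw h =>
    hinj hz hw (injOn_discShift ha1 (hm hz) (hm hw) (by rw [← hs z hz, ← hs w hw, h]))
  have hb := hs1 z₀ hz₀
  refine ⟨fun z => discShift (s z₀) (s z), (differentiableOn_discShift hb).comp hsd hsm,
    (injOn_discShift hb).comp hsi hsm,
    fun z hz => mem_ball_zero_iff.2 (norm_discShift_lt_one hb (hs1 z hz)), by simp [discShift], ?_⟩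
  have hab : a = -s z₀ ^ 2 := by rw [hs z₀ hz₀, hf0]; simp [discShift]
  have hs1' := hs z₁ hz₁
  rw [discShift, eq_div_iff (one_sub_conj_mul_ne_zero ha1 (hfn z₁ hz₁)), hab] at hs1'
  have hd1 := one_sub_conj_mul_ne_zero hb (hs1 z₁ hz₁)
  have hb' : ‖-s z₀‖ < 1 := by rwa [norm_neg]
  have hd2 := one_sub_conj_mul_ne_zero hb' (hs1 z₁ hz₁)
  have hprod : f z₁ = discShift (s z₀) (s z₁) * discShift (-s z₀) (s z₁) := by
    rw [discShift, discShift, div_mul_div_comm, eq_div_iff (mul_ne_zero hd1 hd2)]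
    simp only [map_neg, map_pow] at hs1' ⊢
    linear_combination -hs1'
  have hpos : 0 < ‖discShift (s z₀) (s z₁)‖ := by
    rw [norm_pos_iff, discShift]
    exact div_ne_zero (sub_ne_zero.2 fun h => hne (hsi hz₁ hz₀ h)) hd1
  rw [hprod, norm_mul]
  exact mul_lt_of_lt_one_right hpos (norm_discShift_lt_one hb' (hs1 z₁ hz₁))

theorem exists_image_eq_ball {U : Set ℂ} (hU : IsOpen U) (hUb : Bornology.IsBounded U)
    (hUc : IsPreconnected U) (hUn : U.Nonempty)
    (hsq : ∀ f : ℂ → ℂ, DifferentiableOn ℂ f U → InjOn f U → (∀ z ∈ U, f z ≠ 0) →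
      ∃ s, DifferentiableOn ℂ s U ∧ ∀ z ∈ U, s z ^ 2 = f z) :
    ∃ f : ℂ → ℂ, DifferentiableOn ℂ f U ∧ InjOn f U ∧ f '' U = ball 0 1 := by
  obtain ⟨z₀, hz₀⟩ := hUn
  obtain ⟨z₁, hz₁, hne⟩ : ∃ z₁ ∈ U, z₁ ≠ z₀ := by
    obtain ⟨r, hr, hball⟩ := Metric.isOpen_iff.1 hU z₀ hz₀
    refine ⟨z₀ + (r / 2 : ℝ), hball ?_, by simp [hr.ne']⟩
    rw [mem_ball, dist_eq_norm, add_sub_cancel_left, Complex.norm_real, Real.norm_eq_abs,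
      abs_of_pos (by positivity)]
    linarith
  set F : Set (ℂ → ℂ) :=
    {f | DifferentiableOn ℂ f U ∧ InjOn f U ∧ MapsTo f U (ball 0 1) ∧ f z₀ = 0} with hF
  have hFn : F.Nonempty := by
    obtain ⟨R, hR⟩ := hUb.subset_ball z₀
    have hR0 : 0 < R := pos_of_mem_ball (hR hz₀)
    refine ⟨fun z => (z - z₀) / R, (differentiableOn_id.sub_const _).div_const _,
      fun z _ w _ h => ?_, fun z hz => ?_, by simp⟩
    · have hR' : (R : ℂ) ≠ 0 := by exact_mod_cast hR0.ne'
      simpa [div_left_inj' hR'] using h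
    · rw [mem_ball_zero_iff, norm_div, Complex.norm_real, Real.norm_eq_abs, abs_of_pos hR0,
        div_lt_one hR0, ← dist_eq_norm]
      exact hR hz
  set S : Set ℝ := (fun f : ℂ → ℂ => ‖f z₁‖) '' F
  have hSb : BddAbove S := ⟨1, by
    rintro _ ⟨f, hf, rfl⟩
    exact (mem_ball_zero_iff.1 (hf.2.2.1 hz₁)).le⟩
  obtain ⟨u, -, hu, huS⟩ := exists_seq_tendsto_sSup (hFn.image _) hSb
  choose f hfF hfu using huS
  obtain ⟨g, hg, hgm⟩ := exists_tendstoLocallyUniformlyOn_of_mapsTo_ball (Filter.hyperfilter ℕ) hU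
    (fun n => (hfF n).1) (fun n => (hfF n).2.2.1)
  have hgd : DifferentiableOn ℂ g U :=
    hg.differentiableOn (Filter.Eventually.of_forall fun n => (hfF n).1) hU
  have hg0 : g z₀ = 0 := tendsto_nhds_unique (hg.tendsto_at hz₀)
    (by simp only [(hfF _).2.2.2]; exact tendsto_const_nhds)
  have hg1 : ‖g z₁‖ = sSup S := tendsto_nhds_unique (hg.tendsto_at hz₁).norm
    ((hu.mono_left Nat.hyperfilter_le_atTop).congr fun n => (hfu n).symm)
  have hmax : ∀ h ∈ F, ‖h z₁‖ ≤ ‖g z₁‖ := fun h hh => hg1 ▸ le_csSup hSb ⟨h, hh, rfl⟩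
  have hg1' : g z₁ ≠ 0 := fun h0 => by
    obtain ⟨h, hh⟩ := hFn
    have := hmax h hh
    rw [h0, norm_zero, norm_le_zero_iff] at this
    exact hne (hh.2.1 hz₁ hz₀ (this.trans hh.2.2.2.symm))
  have hgi : InjOn g U := hg.injOn hU hUc (fun n => (hfF n).1) (fun n => (hfF n).2.1)
    ⟨z₁, hz₁, z₀, hz₀, by rwa [hg0]⟩
  have hgm' : MapsTo g U (ball 0 1) := by
    rw [mapsTo_iff_image_subset, ← interior_closedBall _ one_ne_zero]
    exact interior_maximal hgm.image_subset
      (isOpen_image_of_differentiableOn_injOn hgd hgi hU subset_rfl)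
  refine ⟨g, hgd, hgi, hgm'.image_subset.antisymm fun a ha => ?_⟩
  by_contra haU
  obtain ⟨h, h1, h2, h3, h4, h5⟩ :=
    exists_norm_lt_of_notMem_image hsq hgd hgi hgm' hz₀ hz₁ hne hg0 ha haU
  exact (hmax h ⟨h1, h2, h3, h4⟩).not_gt h5

theorem differentiableOn_invFunOn {U : Set ℂ} {f : ℂ → ℂ} (hU : IsOpen U)
    (hf : DifferentiableOn ℂ f U) (hinj : InjOn f U) :
    DifferentiableOn ℂ (Function.invFunOn f U) (f '' U) := by
  have hleft := hinj.leftInvOn_invFunOn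
  have hcont : ∀ z ∈ U, ContinuousAt (Function.invFunOn f U) (f z) := fun z hz => by
    rw [ContinuousAt, hleft hz]
    intro V hV
    obtain ⟨W, hWV, hWo, hzW⟩ := _root_.mem_nhds_iff.1 hV
    refine Filter.mem_map.2 (Filter.mem_of_superset ((isOpen_image_of_differentiableOn_injOn hf
      hinj (hWo.inter hU) inter_subset_right).mem_nhds ⟨z, ⟨hzW, hz⟩, rfl⟩) ?_)
    rintro _ ⟨w, hw, rfl⟩
    rw [mem_preimage, hleft hw.2]
    exact hWV hw.1
  have hopen : IsOpen (f '' U) := isOpen_image_of_differentiableOn_injOn hf hinj hU subset_rfl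
  have hdiff : ∀ z ∈ U, deriv f z ≠ 0 → DifferentiableAt ℂ (Function.invFunOn f U) (f z) :=
    fun z hz h0 => by
      refine (HasDerivAt.of_local_left_inverse (f := f) (hcont z hz) ?_ h0 ?_).differentiableAt
      · rw [hleft hz]
        exact (hf.differentiableAt (hU.mem_nhds hz)).hasDerivAt
      · filter_upwards [hopen.mem_nhds ⟨z, hz, rfl⟩] with y hy
        exact Function.invFunOn_eq hy
  rintro _ ⟨z, hz, rfl⟩
  refine (Complex.analyticAt_of_differentiable_on_punctured_nhds_of_continuousAt ?_
    (hcont z hz)).differentiableAt.differentiableWithinAt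
  have han : AnalyticAt ℂ f z := hf.analyticAt (hU.mem_nhds hz)
  rcases han.deriv.eventually_eq_zero_or_eventually_ne_zero with h | h
  · exfalso
    obtain ⟨r, hr, hball⟩ := Metric.mem_nhds_iff.1 (Filter.inter_mem h (hU.mem_nhds hz))
    have hz2 : z + (r / 2 : ℝ) ∈ ball z r := by
      rw [mem_ball, dist_eq_norm, add_sub_cancel_left, Complex.norm_real, Real.norm_eq_abs,
        abs_of_pos (by positivity)]
      linarith
    have heq : f (z + (r / 2 : ℝ)) = f z := by
      refine isOpen_ball.is_const_of_deriv_eq_zero (convex_ball z r).isPreconnected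
        (hf.mono fun w hw => (hball hw).2) (fun w hw => (hball hw).1) hz2 (mem_ball_self hr)
    have := hinj (hball hz2).2 hz heq
    simp [hr.ne'] at this
  · rw [eventually_nhdsWithin_iff] at h ⊢
    have htend : Filter.Tendsto (Function.invFunOn f U) (nhds (f z)) (nhds z) := by
      have := hcont z hz
      rwa [ContinuousAt, hleft hz] at this
    filter_upwards [htend.eventually h, hopen.mem_nhds ⟨z, hz, rfl⟩] with y hy hyU hyz
    obtain ⟨w, hw, rfl⟩ := hyU
    rw [hleft hw] at hy
    exact hdiff w hw (hy fun h => hyz (by rw [h]; rfl))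

/-- The Riemann mapping theorem for bounded plane domains with connected complement. -/
theorem exists_differentiableOn_ball_image_eq {U : Set ℂ} (hU : IsOpen U)
    (hUb : Bornology.IsBounded U) (hUc : IsPreconnected U) (hUc' : IsPreconnected Uᶜ)
    (hUn : U.Nonempty) :
    ∃ φ : ℂ → ℂ, DifferentiableOn ℂ φ (ball 0 1) ∧ InjOn φ (ball 0 1) ∧ φ '' ball 0 1 = U := by
  obtain ⟨f, hfd, hfi, hfU⟩ := exists_image_eq_ball hU hUb hUc hUn
    fun f hf hinj h0 => exists_sq_eq_of_injOn hU hUb hUc hUc' hf hinj h0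
  refine ⟨Function.invFunOn f U, ?_, ?_, ?_⟩
  · rw [← hfU]
    exact differentiableOn_invFunOn hU hfd hfi
  · rw [← hfU]
    exact Function.invFunOn_injOn_image f U
  · rw [← hfU]
    exact hfi.leftInvOn_invFunOn.image_image

end RiemannMapping

section LengthArea

open MeasureTheory

theorem mul_exp_mem_ball_one_one_iff {r θ : ℝ} (hr : 0 < r) :
    (r : ℂ) * Complex.exp (θ * Complex.I) ∈ ball (1 : ℂ) 1 ↔ r < 2 * Real.cos θ := by
  rw [mem_ball, dist_eq_norm, ← sq_lt_one_iff₀ (norm_nonneg _), Complex.sq_norm,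
    Complex.exp_mul_I, ← Complex.ofReal_cos, ← Complex.ofReal_sin]
  simp only [Complex.normSq_apply, Complex.sub_re, Complex.sub_im, Complex.mul_re, Complex.mul_im,
    Complex.add_re, Complex.add_im, Complex.ofReal_re, Complex.ofReal_im, Complex.one_re,
    Complex.one_im, Complex.I_re, Complex.I_im]
  have h := Real.sin_sq_add_cos_sq θ
  have key : (r * (Real.cos θ + (Real.sin θ * 0 - 0 * 1)) - 0 * (0 + (Real.sin θ * 1 + 0 * 0)) - 1)
      * (r * (Real.cos θ + (Real.sin θ * 0 - 0 * 1)) - 0 * (0 + (Real.sin θ * 1 + 0 * 0)) - 1)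
      + (r * (0 + (Real.sin θ * 1 + 0 * 0)) + 0 * (Real.cos θ + (Real.sin θ * 0 - 0 * 1)) - 0)
      * (r * (0 + (Real.sin θ * 1 + 0 * 0)) + 0 * (Real.cos θ + (Real.sin θ * 0 - 0 * 1)) - 0)
      = r * (r - 2 * Real.cos θ) + 1 := by
    linear_combination r ^ 2 * h
  rw [key]
  constructor
  · intro h1
    by_contra! h2
    have := mul_nonneg hr.le (sub_nonneg.2 h2)
    linarith
  · intro h1
    have := mul_pos hr (sub_pos.2 h1)
    linarith

theorem enorm_sub_le_lintegral_arc {φ : ℂ → ℂ} (hφ : DifferentiableOn ℂ φ (ball 1 1)) {r α β : ℝ}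
    (hr : 0 < r) (hαβ : α ≤ β) (hα : α ∈ Ioo (-(Real.pi / 2)) (Real.pi / 2))
    (hβ : β ∈ Ioo (-(Real.pi / 2)) (Real.pi / 2))
    (hα' : r < 2 * Real.cos α) (hβ' : r < 2 * Real.cos β) :
    ‖φ (r * Complex.exp (β * Complex.I)) - φ (r * Complex.exp (α * Complex.I))‖ₑ ≤
      ∫⁻ θ in Ioo (-Real.pi) Real.pi, (ball (1 : ℂ) 1).indicator
        (fun z => ENNReal.ofReal (r * ‖deriv φ z‖)) (r * Complex.exp (θ * Complex.I)) := by
  have hmem : ∀ θ ∈ Icc α β, (r : ℂ) * Complex.exp (θ * Complex.I) ∈ ball (1 : ℂ) 1 := by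
    intro θ hθ
    rw [mul_exp_mem_ball_one_one_iff hr]
    have := strictConcaveOn_cos_Icc.concaveOn.min_le_of_mem_Icc (Ioo_subset_Icc_self hα)
      (Ioo_subset_Icc_self hβ) hθ
    rcases min_le_iff.1 this with h | h <;> linarith
  have hcd : ContDiffOn ℝ 1 (fun θ : ℝ => φ (r * Complex.exp (θ * Complex.I))) (Icc α β) := by
    refine ContDiffOn.comp (t := ball 1 1) ?_ ?_ hmem
    · exact (hφ.contDiffOn isOpen_ball).restrict_scalars ℝ
    · have : ContDiff ℝ 1 fun θ : ℝ => (r : ℂ) * Complex.exp (θ * Complex.I) := by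
        have h1 : ContDiff ℝ 1 (Complex.ofRealCLM : ℝ → ℂ) := Complex.ofRealCLM.contDiff
        exact contDiff_const.mul (h1.mul contDiff_const).cexp
      exact this.contDiffOn
  refine (enorm_sub_le_lintegral_deriv_of_contDiffOn_Icc hcd hαβ).trans ?_
  have hsub : Icc α β ⊆ Ioo (-Real.pi) Real.pi := fun θ hθ =>
    ⟨by linarith [hα.1, hθ.1, Real.pi_pos], by linarith [hβ.2, hθ.2, Real.pi_pos]⟩
  refine le_trans ?_ (lintegral_mono_set hsub)
  refine setLIntegral_mono' measurableSet_Icc fun θ hθ => ?_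
  rw [indicator_of_mem (hmem θ hθ)]
  have h1 : HasDerivAt (fun θ : ℝ => (r : ℂ) * Complex.exp (θ * Complex.I))
      (r * (Complex.exp (θ * Complex.I) * (1 * Complex.I))) θ :=
    (((hasDerivAt_id θ).ofReal_comp.mul_const Complex.I).cexp).const_mul _
  have h2 := (hφ.differentiableAt (isOpen_ball.mem_nhds (hmem θ hθ))).hasDerivAt.comp_of_eq θ h1 rfl
  have h3 : deriv (fun θ : ℝ => φ (r * Complex.exp (θ * Complex.I))) θ = _ := h2.deriv
  rw [h3, ← ofReal_norm]
  apply ENNReal.ofReal_le_ofReal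
  rw [norm_mul, norm_mul, norm_mul, Complex.norm_exp_ofReal_mul_I, one_mul, one_mul,
    Complex.norm_I, mul_one, Complex.norm_real, Real.norm_eq_abs, abs_of_pos hr, mul_comm]

theorem lintegral_sq_norm_deriv_eq {φ : ℂ → ℂ} {U : Set ℂ} (hU : IsOpen U)
    (hφ : DifferentiableOn ℂ φ U) (hinj : InjOn φ U) :
    ∫⁻ z in U, ENNReal.ofReal (‖deriv φ z‖ ^ 2) = volume (φ '' U) := by
  rw [← lintegral_abs_det_fderiv_eq_addHaar_image volume hU.measurableSet
    (f' := fun z => (ContinuousLinearMap.toSpanSingleton ℂ (deriv φ z)).restrictScalars ℝ)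
    (fun z hz => ?_) hinj]
  · refine lintegral_congr fun z => ?_
    have h : ((ContinuousLinearMap.toSpanSingleton ℂ (deriv φ z)).restrictScalars ℝ).det =
        Complex.normSq (deriv φ z) := by
      rw [← Algebra.norm_complex_apply, Algebra.norm_apply, ContinuousLinearMap.det]
      congr 1
      ext
      simp [mul_comm]
    rw [h, abs_of_nonneg (Complex.normSq_nonneg _), Complex.sq_norm]
  · exact ((hφ.differentiableAt (hU.mem_nhds hz)).hasDerivAt.hasFDerivAt.restrictScalars
      ℝ).hasFDerivWithinAt

theorem lintegral_inv_Ioo_eq_top {δ : ℝ} (hδ : 0 < δ) :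
    ∫⁻ r in Ioo 0 δ, ENNReal.ofReal r⁻¹ = ⊤ := by
  by_contra hne
  have hmeas : Measurable fun r : ℝ => r⁻¹ := measurable_inv
  have hint : IntegrableOn (fun r : ℝ => r⁻¹) (Ioo 0 δ) := by
    refine ⟨hmeas.aestronglyMeasurable, ?_⟩
    rw [hasFiniteIntegral_iff_ofReal]
    · exact lt_top_iff_ne_top.2 hne
    · filter_upwards [self_mem_ae_restrict measurableSet_Ioo] with r hr
      exact inv_nonneg.2 hr.1.le
  rw [← integrableOn_Ioc_iff_integrableOn_Ioo,
    ← intervalIntegrable_iff_integrableOn_Ioc_of_le hδ.le, intervalIntegrable_inv_iff] at hint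
  rcases hint with h | h
  · exact hδ.ne h
  · exact h left_mem_uIcc

/-- The length-area principle: an injective bounded holomorphic function oscillates little on
some small circular arcs around a boundary point. -/
theorem exists_forall_norm_eq_dist_le {φ : ℂ → ℂ} (hφ : DifferentiableOn ℂ φ (ball 1 1))
    (hinj : InjOn φ (ball 1 1)) (hb : Bornology.IsBounded (φ '' ball 1 1)) {ε δ : ℝ}
    (hε : 0 < ε) (hδ : 0 < δ) :
    ∃ r ∈ Ioo 0 δ, ∀ z ∈ ball (1 : ℂ) 1, ∀ w ∈ ball (1 : ℂ) 1, ‖z‖ = r → ‖w‖ = r →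
      dist (φ z) (φ w) ≤ ε := by
  by_contra! hcon
  set G : ℂ → ENNReal := (ball (1 : ℂ) 1).indicator fun z => ENNReal.ofReal (‖deriv φ z‖ ^ 2)
  have hG : Measurable G :=
    (((measurable_deriv φ).norm.pow_const 2).ennreal_ofReal).indicator measurableSet_ball
  have hGint : ∫⁻ z, G z ≠ ⊤ := by
    rw [lintegral_indicator measurableSet_ball, lintegral_sq_norm_deriv_eq isOpen_ball hφ hinj]
    exact hb.measure_lt_top.ne
  set A : ℝ → ENNReal := fun r =>
    ∫⁻ θ in Ioo (-Real.pi) Real.pi, G (r * Complex.exp (θ * Complex.I))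
  have hpolar : ∫⁻ r in Ioi (0 : ℝ), ENNReal.ofReal r * A r = ∫⁻ z, G z := by
    have hme : Measurable fun p : ℝ × ℝ => (p.1 : ℂ) * Complex.exp (p.2 * Complex.I) := by
      fun_prop
    have h1 : ∀ p : ℝ × ℝ, Complex.polarCoord.symm p = p.1 * Complex.exp (p.2 * Complex.I) :=
      fun p => by rw [Complex.polarCoord_symm_apply, Complex.exp_mul_I, Complex.ofReal_cos,
        Complex.ofReal_sin]
    rw [← Complex.lintegral_comp_polarCoord_symm, polarCoord_target, Measure.volume_eq_prod,
      setLIntegral_prod]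
    · refine lintegral_congr fun r => ?_
      simp only [smul_eq_mul, h1]
      rw [lintegral_const_mul]
      exact hG.comp (hme.comp measurable_prodMk_left)
    · simp only [smul_eq_mul, h1]
      exact ((measurable_fst.ennreal_ofReal).mul (hG.comp hme)).aemeasurable
  have hpi := Real.pi_pos
  set l : ℝ := ε / (4 * Real.pi) with hl
  have hl0 : 0 < l := by positivity
  have hArc : ∀ r ∈ Ioo 0 δ, ENNReal.ofReal ε ≤
      ENNReal.ofReal (ε / 2) + ENNReal.ofReal (r ^ 2 / l) * A r := by
    intro r hr
    have hstep : ∀ z ∈ ball (1 : ℂ) 1, ∀ w ∈ ball (1 : ℂ) 1, ‖z‖ = r → ‖w‖ = r → z.arg ≤ w.arg →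
        ENNReal.ofReal (dist (φ w) (φ z)) ≤
          ENNReal.ofReal (ε / 2) + ENNReal.ofReal (r ^ 2 / l) * A r := by
      intro z hz w hw hzr hwr hle
      have hpol : ∀ z ∈ ball (1 : ℂ) 1, ‖z‖ = r → (r : ℂ) * Complex.exp (z.arg * Complex.I) = z ∧
          z.arg ∈ Ioo (-(Real.pi / 2)) (Real.pi / 2) ∧ r < 2 * Real.cos z.arg := by
        intro z hz hzr
        have h1 : (r : ℂ) * Complex.exp (z.arg * Complex.I) = z := by
          rw [← hzr, Complex.norm_mul_exp_arg_mul_I]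
        have h2 : r < 2 * Real.cos z.arg := by
          rw [← mul_exp_mem_ball_one_one_iff hr.1, h1]
          exact hz
        refine ⟨h1, ?_, h2⟩
        have h3 : |z.arg| < Real.pi / 2 := by
          rw [Complex.abs_arg_lt_pi_div_two_iff]
          left
          have h4 : 0 < ‖z‖ * Real.cos z.arg :=
            mul_pos (hzr.symm ▸ hr.1) (by linarith [hr.1])
          rwa [Complex.norm_mul_cos_arg] at h4
        exact abs_lt.1 h3
      obtain ⟨hz1, hz2, hz3⟩ := hpol z hz hzr
      obtain ⟨hw1, hw2, hw3⟩ := hpol w hw hwr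
      have h := enorm_sub_le_lintegral_arc hφ hr.1 hle hz2 hw2 hz3 hw3
      rw [hz1, hw1, ← ofReal_norm, ← dist_eq_norm] at h
      refine h.trans ?_
      have hpt : ∀ z, (ball (1 : ℂ) 1).indicator (fun z => ENNReal.ofReal (r * ‖deriv φ z‖)) z ≤
          ENNReal.ofReal l + ENNReal.ofReal (r ^ 2 / l) * G z := by
        intro z
        by_cases hz : z ∈ ball (1 : ℂ) 1
        · have hGz : G z = ENNReal.ofReal (‖deriv φ z‖ ^ 2) := indicator_of_mem hz _
          rw [indicator_of_mem hz, hGz, ← ENNReal.ofReal_mul (by positivity),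
            ← ENNReal.ofReal_add hl0.le (by positivity)]
          apply ENNReal.ofReal_le_ofReal
          have h1 : r ^ 2 / l * ‖deriv φ z‖ ^ 2 = (r * ‖deriv φ z‖) ^ 2 / l := by ring
          rw [h1, ← sub_nonneg]
          have h2 : l + (r * ‖deriv φ z‖) ^ 2 / l - r * ‖deriv φ z‖ =
              ((l - r * ‖deriv φ z‖ / 2) ^ 2 + 3 / 4 * (r * ‖deriv φ z‖) ^ 2) / l := by
            field_simp
            ring
          rw [h2]
          positivity
        · rw [indicator_of_notMem hz]
          exact zero_le
      refine (lintegral_mono fun θ => hpt _).trans ?_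
      have hGm : Measurable fun θ : ℝ => G (r * Complex.exp (θ * Complex.I)) :=
        hG.comp (by fun_prop)
      rw [lintegral_add_left measurable_const, setLIntegral_const, Real.volume_Ioo,
        ← ENNReal.ofReal_mul hl0.le, lintegral_const_mul _ hGm]
      refine add_le_add (ENNReal.ofReal_le_ofReal (le_of_eq ?_)) le_rfl
      rw [hl]
      field_simp
      ring
    obtain ⟨z, hz, w, hw, hzr, hwr, hlt⟩ := hcon r hr
    rcases le_total z.arg w.arg with hle | hle
    · refine (ENNReal.ofReal_le_ofReal ?_).trans (hstep z hz w hw hzr hwr hle)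
      rw [dist_comm]
      exact hlt.le
    · exact (ENNReal.ofReal_le_ofReal hlt.le).trans (hstep w hw z hz hwr hzr hle)
  have hlow : ∀ r ∈ Ioo 0 δ, ENNReal.ofReal (ε / 2 * l) * ENNReal.ofReal r⁻¹ ≤
      ENNReal.ofReal r * A r := by
    intro r hr
    have hr0 := hr.1
    have h1 := hArc r hr
    rw [show ε = ε / 2 + ε / 2 by ring, ENNReal.ofReal_add (by positivity) (by positivity),
      show (ε / 2 + ε / 2) = ε by ring] at h1
    have h2 := (ENNReal.add_le_add_iff_left ENNReal.ofReal_ne_top).1 h1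
    calc ENNReal.ofReal (ε / 2 * l) * ENNReal.ofReal r⁻¹
        = ENNReal.ofReal (l / r) * ENNReal.ofReal (ε / 2) := by
          rw [← ENNReal.ofReal_mul (by positivity), ← ENNReal.ofReal_mul (by positivity)]
          congr 1
          ring
      _ ≤ ENNReal.ofReal (l / r) * (ENNReal.ofReal (r ^ 2 / l) * A r) := by gcongr
      _ = ENNReal.ofReal r * A r := by
          rw [← mul_assoc, ← ENNReal.ofReal_mul (by positivity)]
          congr 2
          field_simp
  apply hGint
  rw [← hpolar, eq_top_iff]
  calc ⊤ = ENNReal.ofReal (ε / 2 * l) * ∫⁻ r in Ioo 0 δ, ENNReal.ofReal r⁻¹ := by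
        rw [lintegral_inv_Ioo_eq_top hδ, ENNReal.mul_top]
        exact (ENNReal.ofReal_pos.2 (by positivity)).ne'
    _ = ∫⁻ r in Ioo 0 δ, ENNReal.ofReal (ε / 2 * l) * ENNReal.ofReal r⁻¹ := by
        rw [lintegral_const_mul _ (by fun_prop)]
    _ ≤ ∫⁻ r in Ioo 0 δ, ENNReal.ofReal r * A r := setLIntegral_mono' measurableSet_Ioo hlow
    _ ≤ ∫⁻ r in Ioi (0 : ℝ), ENNReal.ofReal r * A r := lintegral_mono_set Ioo_subset_Ioi_self

end LengthArea

section Caratheodory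

theorem joinedIn_compl_of_notMem_closedBall {K : Set ℂ} (hKc : IsClosed K) {p : ℂ} {R : ℝ}
    (hK : K ⊆ closedBall p R) {x y : ℂ} (hx : x ∉ closedBall p R) (hy : y ∉ closedBall p R) :
    JoinedIn Kᶜ x y := by
  have hc : Continuous fun z : ℂ => z + p := by fun_prop
  obtain ⟨α, hα⟩ := joinedIn_compl_of_norm_gt (hKc.preimage hc) (R := R)
    (fun z hz => by simpa using hK hz) (x := x - p) (y := y - p)
    (by simpa [dist_eq_norm] using hx) (by simpa [dist_eq_norm] using hy)
  refine ((isPreconnected_range α.continuous).image _ hc.continuousOn).joinedIn_compl hKc ?_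
    ⟨x - p, ⟨0, α.source⟩, by simp⟩ ⟨y - p, ⟨1, α.target⟩, by simp⟩
  rw [Set.disjoint_left]
  rintro _ ⟨_, ⟨t, rfl⟩, rfl⟩ ht
  exact hα t ht

/-- `φ` is a conformal map of the unit disc onto the bounded component of `x₀` in the complement
of the Jordan curve `c`. -/
structure IsJordanRiemannMap (c : ℝ → ℂ) (x₀ : ℂ) (φ : ℂ → ℂ) : Prop where
  isJordanParam : IsJordanParam c
  notMem : x₀ ∉ range c
  isBounded : Bornology.IsBounded (connectedComponentIn (range c)ᶜ x₀)
  differentiableOn : DifferentiableOn ℂ φ (ball 0 1)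
  injOn : InjOn φ (ball 0 1)
  image_ball : φ '' ball 0 1 = connectedComponentIn (range c)ᶜ x₀

namespace IsJordanRiemannMap

variable {c : ℝ → ℂ} {x₀ : ℂ} {φ : ℂ → ℂ}

theorem mem (h : IsJordanRiemannMap c x₀ φ) {z : ℂ} (hz : z ∈ ball (0 : ℂ) 1) :
    φ z ∈ connectedComponentIn (range c)ᶜ x₀ := h.image_ball ▸ mem_image_of_mem φ hz

theorem notMem_range (h : IsJordanRiemannMap c x₀ φ) {z : ℂ} (hz : z ∈ ball (0 : ℂ) 1) :
    φ z ∉ range c := connectedComponentIn_subset _ _ (h.mem hz)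

theorem closure_image (h : IsJordanRiemannMap c x₀ φ) :
    closure (φ '' ball 0 1) = φ '' ball 0 1 ∪ range c := by
  rw [closure_eq_self_union_frontier, h.image_ball,
    h.isJordanParam.frontier_connectedComponentIn h.notMem]

theorem isOpen_image (h : IsJordanRiemannMap c x₀ φ) {V : Set ℂ} (hV : IsOpen V)
    (hVb : V ⊆ ball 0 1) : IsOpen (φ '' V) :=
  isOpen_image_of_differentiableOn_injOn h.differentiableOn h.injOn hV hVb

/-- If a compact `J` meeting the curve in a connected set does not separate two points of the
image, then the set of points mapped into `J` does not separate their preimages. -/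
theorem exists_isPreconnected (h : IsJordanRiemannMap c x₀ φ) {J : Set ℂ} (hJ : IsCompact J)
    (hJc : IsPreconnected (J ∩ range c)) {z w : ℂ} (hz : z ∈ ball (0 : ℂ) 1)
    (hw : w ∈ ball (0 : ℂ) 1) (hzw : JoinedIn Jᶜ (φ z) (φ w)) :
    ∃ P ⊆ ball (0 : ℂ) 1, IsPreconnected P ∧ z ∈ P ∧ w ∈ P ∧ ∀ u ∈ P, φ u ∉ J := by
  have hγ := h.isJordanParam.isCompact_range
  have hzw' : JoinedIn (range c)ᶜ (φ z) (φ w) :=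
    (joinedIn_of_mem_connectedComponentIn hγ.isClosed (h.mem hz)).symm.trans
      (joinedIn_of_mem_connectedComponentIn hγ.isClosed (h.mem hw))
  obtain ⟨α, hα⟩ := hzw.janiszewski hJ hγ hJc hzw'
  have hαU : range α ⊆ φ '' ball 0 1 := by
    rw [h.image_ball, connectedComponentIn_eq (h.mem hz)]
    exact (isPreconnected_range α.continuous).subset_connectedComponentIn ⟨0, α.source⟩
      (range_subset_iff.2 fun t ht => hα t (Or.inr ht))
  have hleft := h.injOn.leftInvOn_invFunOn
  refine ⟨Function.invFunOn φ (ball 0 1) '' range α, ?_, ?_, ⟨φ z, ⟨0, α.source⟩, hleft hz⟩,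
    ⟨φ w, ⟨1, α.target⟩, hleft hw⟩, ?_⟩
  · rintro _ ⟨y, hy, rfl⟩
    exact Function.invFunOn_mem (hαU hy)
  · exact (isPreconnected_range α.continuous).image _
      ((differentiableOn_invFunOn isOpen_ball h.differentiableOn h.injOn).continuousOn.mono hαU)
  · rintro _ ⟨_, ⟨t, rfl⟩, rfl⟩ ht
    rw [Function.invFunOn_eq (hαU (mem_range_self t))] at ht
    exact hα t (Or.inl ht)

theorem exists_dist_le_near (h : IsJordanRiemannMap c x₀ φ) {ζ : ℂ} (hζ : ‖ζ‖ = 1) {ε δ : ℝ}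
    (hε : 0 < ε) (hδ : 0 < δ) :
    ∃ r ∈ Ioo 0 δ, ∀ z ∈ ball (0 : ℂ) 1, ∀ w ∈ ball (0 : ℂ) 1, dist z ζ = r → dist w ζ = r →
      dist (φ z) (φ w) ≤ ε := by
  have hζ0 : ζ ≠ 0 := norm_pos_iff.1 (by rw [hζ]; exact one_pos)
  have hmem : ∀ z : ℂ, ζ * (1 - z) ∈ ball (0 : ℂ) 1 ↔ z ∈ ball (1 : ℂ) 1 := fun z => by
    rw [mem_ball_zero_iff, norm_mul, hζ, one_mul, mem_ball, dist_comm, dist_eq_norm]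
  have hmaps : MapsTo (fun z : ℂ => ζ * (1 - z)) (ball 1 1) (ball 0 1) := fun z hz => (hmem z).2 hz
  obtain ⟨r, hr, hrφ⟩ := exists_forall_norm_eq_dist_le (φ := fun z => φ (ζ * (1 - z)))
    (h.differentiableOn.comp (by fun_prop) hmaps)
    (h.injOn.comp (fun z _ w _ hzw => by simpa [hζ0] using hzw) hmaps)
    (h.isBounded.subset (by
      rw [← h.image_ball]
      rintro _ ⟨z, hz, rfl⟩
      exact ⟨_, hmaps hz, rfl⟩)) hε hδ
  have hinv : ∀ z : ℂ, ζ * (1 - (1 - z / ζ)) = z := fun z => by field_simp; ring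
  have hnorm : ∀ z : ℂ, ‖1 - z / ζ‖ = dist z ζ := fun z => by
    rw [dist_comm, dist_eq_norm, ← one_mul ‖1 - z / ζ‖, ← hζ, ← norm_mul]
    congr 1
    field_simp
  refine ⟨r, hr, fun z hz w hw hzr hwr => ?_⟩
  have := hrφ (1 - z / ζ) ((hmem _).1 (by rwa [hinv])) (1 - w / ζ) ((hmem _).1 (by rwa [hinv]))
    (by rw [hnorm, hzr]) (by rw [hnorm, hwr])
  simpa only [hinv] using this

theorem exists_dist_le (h : IsJordanRiemannMap c x₀ φ) {ζ : ℂ} (hζ : ‖ζ‖ = 1) {ε : ℝ}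
    (hε : 0 < ε) :
    ∃ r > 0, ∀ z ∈ ball (0 : ℂ) 1, ∀ w ∈ ball (0 : ℂ) 1, dist z ζ < r → dist w ζ < r →
      dist (φ z) (φ w) ≤ ε := by
  have h0 : (0 : ℂ) ∈ ball (0 : ℂ) 1 := mem_ball_self one_pos
  obtain ⟨ρ, hρ, hρb⟩ := Metric.isOpen_iff.1 (h.isOpen_image (isOpen_ball (x := 0) (ε := 1 / 2))
    (ball_subset_ball (by norm_num))) (φ 0) ⟨0, mem_ball_self (by norm_num), rfl⟩
  set e := min (ε / 4) (ρ / 4) with he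
  have he0 : 0 < e := by positivity
  have heε : 4 * e ≤ ε := by linarith [min_le_left (ε / 4) (ρ / 4)]
  have heρ : 4 * e ≤ ρ := by linarith [min_le_right (ε / 4) (ρ / 4)]
  obtain ⟨η, hη, hηA⟩ := h.isJordanParam.exists_small_arc he0
  obtain ⟨r, hr, hrφ⟩ := h.exists_dist_le_near hζ (ε := min (η / 2) e) (δ := 1 / 2)
    (by positivity) (by norm_num)
  set C := {z ∈ ball (0 : ℂ) 1 | dist z ζ = r}
  set p := φ ((1 - r : ℝ) * ζ)
  have hpC : ((1 - r : ℝ) * ζ : ℂ) ∈ C := by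
    have h1 : 0 < 1 - r := by linarith [hr.2]
    refine ⟨?_, ?_⟩
    · rw [mem_ball_zero_iff, norm_mul, hζ, Complex.norm_real, Real.norm_eq_abs, abs_of_pos h1]
      linarith [hr.1]
    · rw [dist_eq_norm, show ((1 - r : ℝ) * ζ - ζ : ℂ) = -((r : ℝ) * ζ) by push_cast; ring,
        norm_neg, norm_mul, hζ, Complex.norm_real, Real.norm_eq_abs, abs_of_pos hr.1, mul_one]
  set K := closure (φ '' C)
  have hKdist : ∀ z ∈ K, ∀ w ∈ K, dist z w ≤ min (η / 2) e := by
    intro z hz w hw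
    have hcl : IsClosed {q : ℂ × ℂ | dist q.1 q.2 ≤ min (η / 2) e} :=
      isClosed_le (by fun_prop) continuous_const
    have : (z, w) ∈ closure ((φ '' C) ×ˢ (φ '' C)) := by rw [closure_prod_eq]; exact ⟨hz, hw⟩
    refine closure_minimal ?_ hcl this
    rintro ⟨_, _⟩ ⟨⟨u, hu, rfl⟩, ⟨v, hv, rfl⟩⟩
    exact hrφ u hu.1 v hv.1 hu.2 hv.2
  have hpK : p ∈ K := subset_closure ⟨_, hpC, rfl⟩
  have hKb : K ⊆ closedBall p (2 * e) := fun z hz => by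
    rw [mem_closedBall]
    linarith [hKdist z hz p hpK, min_le_right (η / 2) e]
  have hKc : IsCompact K := (isCompact_closedBall p (2 * e)).of_isClosed_subset isClosed_closure hKb
  obtain ⟨A, hAγ, hAc, hAp, hKA, hAb⟩ : ∃ A ⊆ range c, IsCompact A ∧ IsPreconnected A ∧
      K ∩ range c ⊆ A ∧ A ⊆ closedBall p (2 * e) := by
    rcases (K ∩ range c).eq_empty_or_nonempty with hemp | ⟨q, hq⟩
    · exact ⟨∅, empty_subset _, isCompact_empty, isPreconnected_empty, hemp.le, empty_subset _⟩
    · obtain ⟨A, hAγ, hAc, hAp, hKA, hAd⟩ := hηA (K ∩ range c) inter_subset_right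
        fun z hz w hw => by
          linarith [hKdist z hz.1 w hw.1, min_le_left (η / 2) e]
      refine ⟨A, hAγ, hAc, hAp, hKA, fun z hz => ?_⟩
      rw [mem_closedBall]
      linarith [dist_triangle z q p, hAd z hz q (hKA hq), hKdist q hq.1 p hpK,
        min_le_right (η / 2) e]
  have hJγ : (K ∪ A) ∩ range c = A := by
    rw [union_inter_distrib_right, inter_eq_left.2 hAγ]
    exact union_eq_right.2 hKA
  have hpρ : ρ ≤ dist (φ 0) p := by
    by_contra! hlt
    rw [dist_comm] at hlt
    obtain ⟨w, hw, hwp⟩ := hρb hlt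
    have := h.injOn (ball_subset_ball (by norm_num) hw) hpC.1 hwp
    rw [this, mem_ball_zero_iff, norm_mul, hζ, Complex.norm_real, Real.norm_eq_abs,
      abs_of_pos (by linarith [hr.2])] at hw
    linarith [hr.2]
  have hclaim : ∀ z ∈ ball (0 : ℂ) 1, dist z ζ < r → dist (φ z) p ≤ 2 * e := by
    intro z hz hzr
    by_contra! hlt
    obtain ⟨P, hPb, hPc, hzP, h0P, hPJ⟩ := h.exists_isPreconnected (hKc.union hAc)
      (hJγ.symm ▸ hAp) hz h0 (joinedIn_compl_of_notMem_closedBall (hKc.union hAc).isClosed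
        (union_subset hKb hAb) (by simpa using hlt) (by rw [mem_closedBall]; linarith))
    obtain ⟨u, hu, hur⟩ := hPc.intermediate_value hzP h0P (f := fun u => dist u ζ)
      (by fun_prop) (show r ∈ Icc _ _ from ⟨hzr.le, by
        rw [dist_comm, dist_zero_right, hζ]; linarith [hr.2]⟩)
    exact hPJ u hu (Or.inl (subset_closure ⟨u, ⟨hPb hu, hur⟩, rfl⟩))
  refine ⟨r, hr.1, fun z hz w hw hzr hwr => ?_⟩
  linarith [dist_triangle_right (φ z) (φ w) p, hclaim z hz hzr, hclaim w hw hwr]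

theorem continuousOn_extendFrom (h : IsJordanRiemannMap c x₀ φ) :
    ContinuousOn (extendFrom (ball 0 1) φ) (closedBall 0 1) := by
  have hcl : closure (ball (0 : ℂ) 1) = closedBall 0 1 := closure_ball 0 one_ne_zero
  refine _root_.continuousOn_extendFrom hcl.ge fun ζ hζ => ?_
  rcases (mem_closedBall_zero_iff.1 hζ).lt_or_eq with hlt | heq
  · exact ⟨φ ζ, h.differentiableOn.continuousOn ζ (mem_ball_zero_iff.2 hlt)⟩
  · have hne : (nhdsWithin ζ (ball (0 : ℂ) 1)).NeBot := mem_closure_iff_nhdsWithin_neBot.1 (hcl ▸ hζ)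
    rw [← cauchy_map_iff_exists_tendsto, Metric.cauchy_iff]
    refine ⟨hne.map _, fun ε hε => ?_⟩
    obtain ⟨r, hr, hrφ⟩ := h.exists_dist_le heq (half_pos hε)
    refine ⟨φ '' (ball ζ r ∩ ball 0 1), Filter.image_mem_map (Filter.inter_mem
      (mem_nhdsWithin_of_mem_nhds (ball_mem_nhds _ hr)) self_mem_nhdsWithin), ?_⟩
    rintro _ ⟨z, hz, rfl⟩ _ ⟨w, hw, rfl⟩
    exact (hrφ z hz.2 w hw.2 hz.1 hw.1).trans_lt (half_lt_self hε)

theorem extendFrom_eq (h : IsJordanRiemannMap c x₀ φ) {z : ℂ} (hz : z ∈ ball (0 : ℂ) 1) :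
    extendFrom (ball 0 1) φ z = φ z :=
  extendFrom_extends h.differentiableOn.continuousOn z hz

theorem extendFrom_image_ball (h : IsJordanRiemannMap c x₀ φ) :
    extendFrom (ball 0 1) φ '' ball 0 1 = φ '' ball 0 1 :=
  image_congr fun _ hz => h.extendFrom_eq hz

theorem extendFrom_image_closedBall (h : IsJordanRiemannMap c x₀ φ) :
    extendFrom (ball 0 1) φ '' closedBall 0 1 = φ '' ball 0 1 ∪ range c := by
  have hcl : closure (ball (0 : ℂ) 1) = closedBall 0 1 := closure_ball 0 one_ne_zero
  rw [← h.closure_image, ← h.extendFrom_image_ball]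
  refine Subset.antisymm ?_ ?_
  · have := h.continuousOn_extendFrom
    rw [← hcl] at this ⊢
    exact this.image_closure
  · exact closure_minimal (image_mono ball_subset_closedBall)
      ((isCompact_closedBall (0 : ℂ) 1).image_of_continuousOn h.continuousOn_extendFrom).isClosed

theorem extendFrom_mem_range (h : IsJordanRiemannMap c x₀ φ) {ζ : ℂ} (hζ : ‖ζ‖ = 1) :
    extendFrom (ball 0 1) φ ζ ∈ range c := by
  have hcl : closure (ball (0 : ℂ) 1) = closedBall 0 1 := closure_ball 0 one_ne_zero
  have hζc : ζ ∈ closedBall (0 : ℂ) 1 := mem_closedBall_zero_iff.2 hζ.le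
  have hmem := h.extendFrom_image_closedBall ▸ mem_image_of_mem (extendFrom (ball 0 1) φ) hζc
  refine hmem.resolve_left fun hU => ?_
  have hne : (nhdsWithin ζ (ball (0 : ℂ) 1)).NeBot := mem_closure_iff_nhdsWithin_neBot.1 (hcl ▸ hζc)
  have hψ : ContinuousAt (Function.invFunOn φ (ball 0 1)) (extendFrom (ball 0 1) φ ζ) :=
    (differentiableOn_invFunOn isOpen_ball h.differentiableOn h.injOn).continuousOn.continuousAt
      ((h.isOpen_image isOpen_ball subset_rfl).mem_nhds hU)
  have hΦ : Filter.Tendsto (extendFrom (ball 0 1) φ) (nhdsWithin ζ (ball 0 1))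
      (nhds (extendFrom (ball 0 1) φ ζ)) :=
    (h.continuousOn_extendFrom ζ hζc).mono_left (nhdsWithin_mono _ ball_subset_closedBall)
  have hlim := hψ.tendsto.comp hΦ
  have hid : Filter.Tendsto (fun z : ℂ => z) (nhdsWithin ζ (ball 0 1)) (nhds ζ) :=
    Filter.tendsto_id.mono_left nhdsWithin_le_nhds
  have heq := tendsto_nhds_unique (hlim.congr' (f₂ := fun z => z) (by
    filter_upwards [self_mem_nhdsWithin] with z hz
    rw [Function.comp_apply, h.extendFrom_eq hz]
    exact h.injOn.leftInvOn_invFunOn hz)) hid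
  have hζb : ζ ∈ ball (0 : ℂ) 1 := heq ▸ Function.invFunOn_mem hU
  rw [mem_ball_zero_iff, hζ] at hζb
  exact hζb.false

end IsJordanRiemannMap

/-- A holomorphic function which is constant on a boundary arc takes this value at the center. -/
theorem eq_of_eqOn_arc {Φ : ℂ → ℂ} (hc : ContinuousOn Φ (closedBall 0 1))
    (hd : DifferentiableOn ℂ Φ (ball 0 1)) {p ζ : ℂ} {s : ℝ} (hs : 0 < s)
    (h : ∀ z, ‖z‖ = 1 → dist z ζ < s → Φ z = p) (hζ : ‖ζ‖ = 1) : Φ 0 = p := by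
  obtain ⟨T, hT, hTs⟩ := (isCompact_sphere (0 : ℂ) 1).elim_nhds_subcover
    (fun x => {z | dist (ζ * starRingEnd ℂ x * z) ζ < s}) fun x hx => by
      refine (isOpen_lt (by fun_prop) continuous_const).mem_nhds ?_
      have : starRingEnd ℂ x * x = 1 := by
        rw [Complex.conj_mul', mem_sphere_zero_iff_norm.1 hx]
        simp
      simp [mul_assoc, this, hs]
  have hnorm : ∀ x ∈ T, ∀ z : ℂ, ‖ζ * starRingEnd ℂ x * z‖ = ‖z‖ := fun x hx z => by
    rw [norm_mul, norm_mul, RCLike.norm_conj, hζ, mem_sphere_zero_iff_norm.1 (hT x hx), one_mul,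
      one_mul]
  have hDC : DiffContOnCl ℂ (fun z => ∏ x ∈ T, (Φ (ζ * starRingEnd ℂ x * z) - p)) (ball 0 1) := by
    refine ⟨?_, ?_⟩
    · refine DifferentiableOn.fun_finsetProd fun x hx => ?_
      refine (hd.comp (by fun_prop) fun z hz => ?_).sub_const p
      rw [mem_ball_zero_iff, hnorm x hx]
      exact mem_ball_zero_iff.1 hz
    · rw [closure_ball 0 one_ne_zero]
      refine continuousOn_finsetProd _ fun x hx => ?_
      refine (hc.comp (by fun_prop) fun z hz => ?_).sub continuousOn_const
      rw [mem_closedBall_zero_iff, hnorm x hx]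
      exact mem_closedBall_zero_iff.1 hz
  have h0 := Complex.norm_le_of_forall_mem_frontier_norm_le isBounded_ball hDC (C := 0)
    (fun z hz => ?_) (subset_closure (mem_ball_self one_pos))
  · obtain ⟨x, -, hx⟩ := Finset.prod_eq_zero_iff.1 (norm_le_zero_iff.1 h0)
    simpa [sub_eq_zero] using hx
  · rw [frontier_ball 0 one_ne_zero] at hz
    obtain ⟨x, hx, hxz⟩ := mem_iUnion₂.1 (hTs hz)
    rw [norm_le_zero_iff]
    refine Finset.prod_eq_zero hx (sub_eq_zero.2 (h _ ?_ hxz))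
    rw [hnorm x hx]
    exact mem_sphere_zero_iff_norm.1 hz

theorem mem_segment_of_im_eq_zero {a b z : ℂ} (ha : ‖a‖ = 1) (hb : ‖b‖ = 1) (hab : a ≠ b)
    (hz : ‖z‖ ≤ 1) (h : ((z - a) * starRingEnd ℂ (b - a)).im = 0) : z ∈ segment ℝ a b := by
  have hba : b - a ≠ 0 := sub_ne_zero.2 hab.symm
  set t := ((z - a) / (b - a)).re with ht
  have him : ((z - a) / (b - a)).im = 0 := by
    rw [div_eq_mul_inv, Complex.inv_def, ← mul_assoc, Complex.im_mul_ofReal, h, zero_mul]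
  have hzt : z = a + t * (b - a) := by
    have : ((t : ℝ) : ℂ) = (z - a) / (b - a) := Complex.ext rfl (by simp [him])
    rw [this]
    field_simp
    ring
  have hsq : ∀ u : ℂ, ‖u‖ ^ 2 = u.re * u.re + u.im * u.im := fun u => by
    rw [Complex.sq_norm, Complex.normSq_apply]
  have ha2 := hsq a
  have hb2 := hsq b
  have hz2 : ‖z‖ ^ 2 ≤ 1 := by nlinarith [norm_nonneg z]
  have hd2 := hsq (b - a)
  have hdpos : 0 < ‖b - a‖ ^ 2 := by positivity
  rw [hsq, hzt] at hz2
  rw [ha] at ha2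
  rw [hb] at hb2
  simp only [Complex.add_re, Complex.add_im, Complex.mul_re, Complex.mul_im, Complex.ofReal_re,
    Complex.ofReal_im, Complex.sub_re, Complex.sub_im] at hz2 hd2
  have hkey : t * (t - 1) * ‖b - a‖ ^ 2 ≤ 0 := by
    rw [hd2]
    linear_combination hz2 + (1 - t) * ha2 + t * hb2
  have hts : t * (t - 1) ≤ 0 := by
    by_contra! hpos
    exact (mul_pos hpos hdpos).not_ge hkey
  rw [segment_eq_image']
  refine ⟨t, ⟨by nlinarith, by nlinarith⟩, ?_⟩
  simp only [Complex.real_smul]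
  exact hzt.symm

theorem exists_norm_eq_one_im_pos {a b : ℂ} (ha : ‖a‖ = 1) (hb : ‖b‖ = 1) (hab : a ≠ b) :
    ∃ z : ℂ, ‖z‖ = 1 ∧ 0 < ((z - a) * starRingEnd ℂ (b - a)).im := by
  set d := b - a
  have hd : ‖d‖ ≠ 0 := norm_ne_zero_iff.2 (sub_ne_zero.2 hab.symm)
  refine ⟨Complex.I * (d / ‖d‖), ?_, ?_⟩
  · rw [norm_mul, norm_div, Complex.norm_I, one_mul, Complex.norm_real, norm_norm, div_self hd]
  have h1 : Complex.I * (d / ‖d‖) * starRingEnd ℂ d = Complex.I * ‖d‖ := by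
    have : d * starRingEnd ℂ d = (‖d‖ : ℂ) ^ 2 := Complex.mul_conj' d
    have hd' : (‖d‖ : ℂ) ≠ 0 := by exact_mod_cast hd
    field_simp
    linear_combination this
  rw [sub_mul, h1, Complex.sub_im]
  have h2 : (a * starRingEnd ℂ d).re ≠ 0 := by
    have e1 : ‖a‖ ^ 2 = a.re * a.re + a.im * a.im := by
      rw [Complex.sq_norm, Complex.normSq_apply]
    have e2 : ‖b‖ ^ 2 = b.re * b.re + b.im * b.im := by
      rw [Complex.sq_norm, Complex.normSq_apply]
    have e3 : ‖d‖ ^ 2 = (b.re - a.re) * (b.re - a.re) + (b.im - a.im) * (b.im - a.im) := by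
      rw [Complex.sq_norm, Complex.normSq_apply]
      rfl
    have e4 : (a * starRingEnd ℂ d).re = a.re * (b.re - a.re) + a.im * (b.im - a.im) := by
      simp only [d, Complex.mul_re, Complex.conj_re, Complex.conj_im, Complex.sub_re,
        Complex.sub_im]
      ring
    have e5 : 0 < ‖d‖ ^ 2 := by positivity
    rw [ha] at e1
    rw [hb] at e2
    rw [e4]
    intro h0
    linarith
  have h3 := Complex.abs_im_lt_norm.2 h2
  rw [norm_mul, RCLike.norm_conj, ha, one_mul] at h3
  have h4 := (abs_lt.1 h3).2
  simpa using h4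

namespace IsJordanRiemannMap

variable {c : ℝ → ℂ} {x₀ : ℂ} {φ : ℂ → ℂ}

theorem exists_mem_ball_near (h : IsJordanRiemannMap c x₀ φ) {u : ℂ} (hu : ‖u‖ = 1) {V W : Set ℂ}
    (hV : V ∈ nhds u) (hW : W ∈ nhds (extendFrom (ball 0 1) φ u)) :
    ∃ u' ∈ ball (0 : ℂ) 1, u' ∈ V ∧ φ u' ∈ W := by
  have hcl : closure (ball (0 : ℂ) 1) = closedBall 0 1 := closure_ball 0 one_ne_zero
  have huc : u ∈ closedBall (0 : ℂ) 1 := mem_closedBall_zero_iff.2 hu.le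
  have hne : (nhdsWithin u (ball (0 : ℂ) 1)).NeBot := mem_closure_iff_nhdsWithin_neBot.1 (hcl ▸ huc)
  have hΦ : Filter.Tendsto (extendFrom (ball 0 1) φ) (nhdsWithin u (ball 0 1))
      (nhds (extendFrom (ball 0 1) φ u)) :=
    (h.continuousOn_extendFrom u huc).mono_left (nhdsWithin_mono _ ball_subset_closedBall)
  obtain ⟨u', ⟨hb, hu'⟩, hW'⟩ := Filter.nonempty_of_mem (Filter.inter_mem
    (Filter.inter_mem self_mem_nhdsWithin (mem_nhdsWithin_of_mem_nhds hV)) (hΦ hW))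
  exact ⟨u', hb, hu', by rwa [mem_preimage, h.extendFrom_eq hb] at hW'⟩

theorem extendFrom_eq_or_eq (h : IsJordanRiemannMap c x₀ φ) {a b u v : ℂ} (ha : ‖a‖ = 1)
    (hb : ‖b‖ = 1) (hab : a ≠ b)
    (hΦ : extendFrom (ball 0 1) φ a = extendFrom (ball 0 1) φ b) (hu : ‖u‖ = 1) (hv : ‖v‖ = 1)
    (hu0 : 0 < ((u - a) * starRingEnd ℂ (b - a)).im)
    (hv0 : ((v - a) * starRingEnd ℂ (b - a)).im < 0) :
    extendFrom (ball 0 1) φ u = extendFrom (ball 0 1) φ a ∨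
      extendFrom (ball 0 1) φ v = extendFrom (ball 0 1) φ a := by
  by_contra! hcon
  set Φ := extendFrom (ball 0 1) φ
  set J := Φ '' segment ℝ a b
  have hac : a ∈ closedBall (0 : ℂ) 1 := mem_closedBall_zero_iff.2 ha.le
  have hbc : b ∈ closedBall (0 : ℂ) 1 := mem_closedBall_zero_iff.2 hb.le
  have hseg : segment ℝ a b ⊆ closedBall 0 1 := (convex_closedBall 0 1).segment_subset hac hbc
  have hJ : IsCompact J := by
    refine IsCompact.image_of_continuousOn ?_ (h.continuousOn_extendFrom.mono hseg)
    rw [segment_eq_image]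
    exact isCompact_Icc.image (by fun_prop)
  have hJγ : J ∩ range c = {Φ a} := by
    refine Subset.antisymm ?_ (singleton_subset_iff.2
      ⟨⟨a, left_mem_segment ℝ a b, rfl⟩, h.extendFrom_mem_range ha⟩)
    rintro _ ⟨⟨z, hz, rfl⟩, hzc⟩
    rw [← insert_endpoints_openSegment] at hz
    rcases hz with rfl | rfl | hz
    · rfl
    · exact hΦ.symm
    · have hzb := openSegment_subset_ball_of_ne hac hbc hab hz
      rw [show Φ z = φ z from h.extendFrom_eq hzb] at hzc
      exact absurd hzc (h.notMem_range hzb)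
  have hnotJ : ∀ w, ‖w‖ = 1 → Φ w ≠ Φ a → ∃ s > 0, ball (Φ w) s ⊆ Jᶜ := fun w hw hwa =>
    Metric.isOpen_iff.1 hJ.isClosed.isOpen_compl _ fun hwJ =>
      hwa (hJγ.subset ⟨hwJ, h.extendFrom_mem_range hw⟩)
  obtain ⟨s, hs, hsJ⟩ := hnotJ u hu hcon.1
  obtain ⟨t, ht, htJ⟩ := hnotJ v hv hcon.2
  have hcont : Continuous fun z : ℂ => ((z - a) * starRingEnd ℂ (b - a)).im := by fun_prop
  obtain ⟨u', hub, huV, huW⟩ := h.exists_mem_ball_near hu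
    (hcont.continuousAt.eventually (lt_mem_nhds hu0)) (ball_mem_nhds _ hs)
  obtain ⟨v', hvb, hvV, hvW⟩ := h.exists_mem_ball_near hv
    (hcont.continuousAt.eventually (gt_mem_nhds hv0)) (ball_mem_nhds _ ht)
  have hP : IsPreconnected (range c \ {Φ a} ∪ ball (Φ u) s ∪ ball (Φ v) t) := by
    have hu1 : Φ u ∈ range c \ {Φ a} := ⟨h.extendFrom_mem_range hu, hcon.1⟩
    have hv1 : Φ v ∈ range c \ {Φ a} := ⟨h.extendFrom_mem_range hv, hcon.2⟩
    exact IsPreconnected.union (Φ v) (Or.inl hv1) (mem_ball_self ht)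
      (IsPreconnected.union (Φ u) hu1 (mem_ball_self hs)
        (h.isJordanParam.isPreconnected_diff_singleton (Φ a)) (convex_ball _ _).isPreconnected)
      (convex_ball _ _).isPreconnected
  have hPJ : Disjoint (range c \ {Φ a} ∪ ball (Φ u) s ∪ ball (Φ v) t) J := by
    rw [Set.disjoint_left]
    rintro z ((hz | hz) | hz) hzJ
    · exact hz.2 (hJγ.subset ⟨hzJ, hz.1⟩)
    · exact hsJ hz hzJ
    · exact htJ hz hzJ
  obtain ⟨P, hPb, hPc, huP, hvP, hPJ'⟩ := h.exists_isPreconnected hJ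
    (hJγ ▸ isPreconnected_singleton) hub hvb
    (hP.joinedIn_compl hJ.isClosed hPJ (Or.inl (Or.inr huW)) (Or.inr hvW))
  obtain ⟨w, hw, hw0⟩ := hPc.intermediate_value hvP huP hcont.continuousOn
    (show (0 : ℝ) ∈ Icc _ _ from ⟨le_of_lt hvV, le_of_lt huV⟩)
  have hwb := hPb hw
  refine hPJ' w hw ⟨w, mem_segment_of_im_eq_zero ha hb hab (mem_ball_zero_iff.1 hwb).le hw0, ?_⟩
  exact h.extendFrom_eq hwb

theorem exists_extendFrom_ne (h : IsJordanRiemannMap c x₀ φ) {a b p : ℂ} (ha : ‖a‖ = 1)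
    (hb : ‖b‖ = 1) (hab : a ≠ b) (hp : p ∈ range c) :
    ∃ u, ‖u‖ = 1 ∧ 0 < ((u - a) * starRingEnd ℂ (b - a)).im ∧ extendFrom (ball 0 1) φ u ≠ p := by
  by_contra! hcon
  obtain ⟨z, hz, hz0⟩ := exists_norm_eq_one_im_pos ha hb hab
  have hcont : Continuous fun z : ℂ => ((z - a) * starRingEnd ℂ (b - a)).im := by fun_prop
  obtain ⟨s, hs, hsb⟩ := Metric.mem_nhds_iff.1 (hcont.continuousAt.eventually (lt_mem_nhds hz0))
  have h0 : (0 : ℂ) ∈ ball (0 : ℂ) 1 := mem_ball_self one_pos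
  have := eq_of_eqOn_arc h.continuousOn_extendFrom
    (h.differentiableOn.congr fun _ hz => h.extendFrom_eq hz) hs
    (fun u hu huz => hcon u hu (hsb huz)) hz
  rw [h.extendFrom_eq h0] at this
  exact h.notMem_range h0 (this ▸ hp)

theorem injOn_extendFrom (h : IsJordanRiemannMap c x₀ φ) :
    InjOn (extendFrom (ball 0 1) φ) (closedBall 0 1) := by
  have hsb : ∀ a b : ℂ, ‖a‖ = 1 → b ∈ ball (0 : ℂ) 1 →
      extendFrom (ball 0 1) φ a ≠ extendFrom (ball 0 1) φ b := fun a b ha hb hab => by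
    rw [h.extendFrom_eq hb] at hab
    exact h.notMem_range hb (hab ▸ h.extendFrom_mem_range ha)
  intro a ha b hb hab
  rcases (mem_closedBall_zero_iff.1 ha).lt_or_eq with ha1 | ha1 <;>
    rcases (mem_closedBall_zero_iff.1 hb).lt_or_eq with hb1 | hb1
  · rw [← mem_ball_zero_iff] at ha1 hb1
    rw [h.extendFrom_eq ha1, h.extendFrom_eq hb1] at hab
    exact h.injOn ha1 hb1 hab
  · exact absurd hab.symm (hsb b a hb1 (mem_ball_zero_iff.2 ha1))
  · exact absurd hab (hsb a b ha1 (mem_ball_zero_iff.2 hb1))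
  · by_contra hne
    have hp := h.extendFrom_mem_range ha1
    obtain ⟨u, hu, hu0, hup⟩ := h.exists_extendFrom_ne ha1 hb1 hne hp
    obtain ⟨v, hv, hv0, hvp⟩ := h.exists_extendFrom_ne hb1 ha1 (Ne.symm hne) hp
    have hv0' : ((v - a) * starRingEnd ℂ (b - a)).im < 0 := by
      simp only [map_sub, Complex.mul_im, Complex.sub_re, Complex.sub_im, Complex.conj_re,
        Complex.conj_im] at hv0 ⊢
      linarith
    exact (h.extendFrom_eq_or_eq ha1 hb1 hne hab hu hv hu0 hv0').elim hup hvp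

end IsJordanRiemannMap

/-- **Carathéodory's theorem**: the closure of a bounded component of the complement of a Jordan
curve is a closed disc. -/
theorem IsJordanParam.exists_closedBall {c : ℝ → ℂ} (h : IsJordanParam c) {x₀ : ℂ}
    (hx₀ : x₀ ∉ range c) (hb : Bornology.IsBounded (connectedComponentIn (range c)ᶜ x₀)) :
    ∃ H : ℂ → ℂ, ContinuousOn H (closedBall 0 1) ∧ InjOn H (closedBall 0 1) ∧
      H '' sphere 0 1 = range c ∧ H '' ball 0 1 = connectedComponentIn (range c)ᶜ x₀ := by
  obtain ⟨φ, hφd, hφi, hφU⟩ := exists_differentiableOn_ball_image_eq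
    h.isCompact_range.isClosed.isOpen_compl.connectedComponentIn hb
    isPreconnected_connectedComponentIn (h.isPreconnected_compl_connectedComponentIn x₀)
    ⟨x₀, mem_connectedComponentIn hx₀⟩
  have hR : IsJordanRiemannMap c x₀ φ := ⟨h, hx₀, hb, hφd, hφi, hφU⟩
  refine ⟨_, hR.continuousOn_extendFrom, hR.injOn_extendFrom, ?_,
    hR.extendFrom_image_ball.trans hφU⟩
  refine Subset.antisymm ?_ fun y hy => ?_
  · rintro _ ⟨z, hz, rfl⟩
    exact hR.extendFrom_mem_range (mem_sphere_zero_iff_norm.1 hz)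
  · obtain ⟨z, hz, rfl⟩ := hR.extendFrom_image_closedBall.superset (Or.inr hy)
    rcases (mem_closedBall_zero_iff.1 hz).lt_or_eq with hz1 | hz1
    · rw [← mem_ball_zero_iff] at hz1
      rw [hR.extendFrom_eq hz1] at hy
      exact absurd hy (hR.notMem_range hz1)
    · exact ⟨z, mem_sphere_zero_iff_norm.2 hz1, rfl⟩

end Caratheodory

section Sphere

theorem exists_openPartialHomeomorph_sphere (p : Sph) :
    ∃ e : OpenPartialHomeomorph Sph ℂ, e.source = {p}ᶜ ∧ e.target = univ := by
  have : Fact (Module.finrank ℝ (EuclideanSpace ℝ (Fin 3)) = 2 + 1) :=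
    ⟨finrank_euclideanSpace_fin⟩
  exact ⟨(stereographic' 2 p).trans
    Complex.orthonormalBasisOneI.repr.symm.toHomeomorph.toOpenPartialHomeomorph,
    by simp, by simp⟩

/-- `c` is a `1`-periodic parametrisation of a simple closed curve in the sphere. -/
structure IsSphereJordanParam (c : ℝ → Sph) : Prop where
  continuous : Continuous c
  eq_iff : ∀ s t, c s = c t ↔ ∃ n : ℤ, s = t + n

namespace IsSphereJordanParam

variable {c : ℝ → Sph} {e : OpenPartialHomeomorph Sph ℂ} {p x y : Sph}

theorem comp (h : IsSphereJordanParam c) (he : e.source = {p}ᶜ) (hp : p ∉ range c) :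
    IsJordanParam (e ∘ c) := by
  have hs : ∀ t, c t ∈ e.source := fun t => by
    rw [he]
    rintro ht
    exact hp ⟨t, ht⟩
  refine ⟨e.continuousOn.comp_continuous h.continuous hs, fun s t => ?_⟩
  rw [← h.eq_iff]
  exact ⟨fun hst => e.injOn (hs s) (hs t) hst, fun hst => congrArg e hst⟩

theorem image_Icc (h : IsSphereJordanParam c) (a : ℝ) : c '' Icc a (a + 1) = range c := by
  refine Subset.antisymm (image_subset_range _ _) ?_
  rintro _ ⟨t, rfl⟩
  refine ⟨t - ⌊t - a⌋, ⟨?_, ?_⟩, (h.eq_iff _ _).2 ⟨-⌊t - a⌋, by push_cast; ring⟩⟩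
  · linarith [Int.floor_le (t - a)]
  · linarith [Int.lt_floor_add_one (t - a)]

theorem isClosed_range (h : IsSphereJordanParam c) : IsClosed (range c) := by
  rw [← h.image_Icc 0]
  exact (isCompact_Icc.image h.continuous).isClosed

theorem injOn_Ico (h : IsSphereJordanParam c) (a : ℝ) : InjOn c (Ico a (a + 1)) := by
  intro s hs t ht hst
  obtain ⟨n, hn⟩ := (h.eq_iff s t).1 hst
  have h1 : (n : ℝ) < (1 : ℤ) := by push_cast; linarith [hs.2, ht.1]
  have h2 : ((-1 : ℤ) : ℝ) < n := by push_cast; linarith [hs.1, ht.2]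
  rw [Int.cast_lt] at h1 h2
  have : n = 0 := by omega
  simpa [this] using hn

theorem range_ne_univ (h : IsSphereJordanParam c) : range c ≠ univ := by
  intro hu
  have hinj := h.injOn_Ico 0
  have h01 : c 1 = c 0 := (h.eq_iff _ _).2 ⟨1, by simp⟩
  obtain ⟨e, hes, het⟩ := exists_openPartialHomeomorph_sphere (c 0)
  set A := c '' Icc 0 (1 / 2)
  set B := c '' Icc (1 / 2) 1
  have hAc : IsClosed A := (isCompact_Icc.image h.continuous).isClosed
  have hBc : IsClosed B := (isCompact_Icc.image h.continuous).isClosed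
  have hAB : ∀ x, x ∈ A ∨ x ∈ B := by
    intro x
    have : x ∈ c '' Icc 0 (0 + 1) := by rw [h.image_Icc 0, hu]; trivial
    obtain ⟨t, ht, rfl⟩ := this
    rw [zero_add] at ht
    rcases le_total t (1 / 2) with h2 | h2
    · exact Or.inl ⟨t, ⟨ht.1, h2⟩, rfl⟩
    · exact Or.inr ⟨t, ⟨h2, ht.2⟩, rfl⟩
  have hABi : ∀ x, x ∈ A → x ∈ B → x = c 0 ∨ x = c (1 / 2) := by
    rintro _ ⟨s, hs, rfl⟩ ⟨t, ht, hts⟩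
    rcases ht.2.lt_or_eq with h1 | rfl
    · have := hinj (show t ∈ Ico 0 (0 + 1) from ⟨by linarith [ht.1], by linarith⟩)
        (show s ∈ Ico 0 (0 + 1) from ⟨hs.1, by linarith [hs.2]⟩) hts
      subst this
      exact Or.inr (congrArg c (le_antisymm hs.2 ht.1))
    · exact Or.inl (hts.symm.trans h01)
  have hh : c (1 / 2) ∈ e.source := by
    rw [hes]
    intro h0
    have := hinj (show (1 / 2 : ℝ) ∈ Ico 0 (0 + 1) by norm_num)
      (show (0 : ℝ) ∈ Ico 0 (0 + 1) by norm_num) h0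
    norm_num at this
  have hP : IsPreconnected (e.symm '' {e (c (1 / 2))}ᶜ) := by
    refine IsPreconnected.image (isConnected_compl_singleton_of_one_lt_rank (by simp)
      _).isPreconnected _ (e.continuousOn_symm.mono (by simp [het]))
  have hPsub : ∀ x, x ≠ c 0 → x ≠ c (1 / 2) → x ∈ e.symm '' {e (c (1 / 2))}ᶜ := by
    intro x hx0 hx1
    have hx : x ∈ e.source := by rwa [hes]
    exact ⟨e x, fun hxe => hx1 (e.injOn hx hh hxe), e.left_inv hx⟩
  have hPne : ∀ x ∈ e.symm '' {e (c (1 / 2))}ᶜ, x ≠ c 0 ∧ x ≠ c (1 / 2) := by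
    rintro _ ⟨z, hz, rfl⟩
    have hzt : z ∈ e.target := by simp [het]
    refine ⟨fun h0 => ?_, fun h1 => hz ?_⟩
    · have := e.map_target hzt
      rw [hes] at this
      exact this h0
    · rw [← h1, e.right_inv hzt]
      rfl
  have hq : ∀ t ∈ Ioo (0 : ℝ) 1, t ≠ 1 / 2 → c t ∈ e.symm '' {e (c (1 / 2))}ᶜ := by
    intro t ht ht2
    have htm : t ∈ Ico (0 : ℝ) (0 + 1) := ⟨ht.1.le, by linarith [ht.2]⟩
    refine hPsub _ (fun h0 => ?_) fun h1 => ?_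
    · exact ht.1.ne' (hinj htm (by norm_num) h0)
    · exact ht2 (hinj htm (by norm_num) h1)
  obtain ⟨x, hxP, hxA, hxB⟩ := (isPreconnected_closed_iff.1 hP) A B hAc hBc
    (fun x _ => hAB x)
    ⟨c (1 / 4), hq _ (by norm_num) (by norm_num), 1 / 4, by norm_num, rfl⟩
    ⟨c (3 / 4), hq _ (by norm_num) (by norm_num), 3 / 4, by norm_num, rfl⟩
  have := hPne x hxP
  rcases hABi x hxA hxB with h0 | h0
  · exact this.1 h0
  · exact this.2 h0

theorem isOpen_component (h : IsSphereJordanParam c) (x : Sph) :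
    IsOpen (connectedComponentIn (range c)ᶜ x) := by
  have := ChartedSpace.locallyConnectedSpace (EuclideanSpace ℝ (Fin 2)) Sph
  exact h.isClosed_range.isOpen_compl.connectedComponentIn

theorem disjoint_component {S : Set Sph} (hx : x ∈ S) (hxp : x ∉ connectedComponentIn S p) :
    Disjoint (connectedComponentIn S x) (connectedComponentIn S p) := by
  rw [Set.disjoint_left]
  intro z hzx hzp
  rw [connectedComponentIn_eq hzp, ← connectedComponentIn_eq hzx] at hxp
  exact hxp (mem_connectedComponentIn hx)

theorem image_component (he : e.source = {p}ᶜ) (het : e.target = univ)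
    (hp : p ∉ range c) (hx : x ∉ range c) (hxp : x ∉ connectedComponentIn (range c)ᶜ p) :
    e '' connectedComponentIn (range c)ᶜ x = connectedComponentIn (range (e ∘ c))ᶜ (e x) := by
  have hpp : p ∈ connectedComponentIn (range c)ᶜ p := mem_connectedComponentIn hp
  have hdisj := disjoint_component hx hxp
  have hsub : connectedComponentIn (range c)ᶜ x ⊆ e.source := fun z hz => by
    rw [he]
    rintro rfl
    exact hdisj.le_bot ⟨hz, hpp⟩
  have hcs : ∀ t, c t ∈ e.source := fun t => by
    rw [he]
    exact fun ht => hp ⟨t, ht⟩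
  have hxx : x ∈ connectedComponentIn (range c)ᶜ x := mem_connectedComponentIn hx
  have hxc : e x ∈ (range (e ∘ c))ᶜ := by
    rintro ⟨t, ht⟩
    exact hx ⟨t, e.injOn (hcs t) (hsub hxx) ht⟩
  refine Subset.antisymm ?_ fun z hz => ?_
  · refine IsPreconnected.subset_connectedComponentIn
      (isPreconnected_connectedComponentIn.image _ (e.continuousOn.mono hsub)) ⟨x, hxx, rfl⟩ ?_
    rintro _ ⟨z, hz, rfl⟩ ⟨t, ht⟩
    exact connectedComponentIn_subset _ _ hz ⟨t, e.injOn (hcs t) (hsub hz) ht⟩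
  · refine ⟨e.symm z, ?_, e.right_inv (by simp [het])⟩
    refine IsPreconnected.subset_connectedComponentIn (x := x)
      (isPreconnected_connectedComponentIn.image _ (e.continuousOn_symm.mono (by simp [het])))
      ⟨e x, mem_connectedComponentIn hxc, e.left_inv (hsub hxx)⟩ ?_ ⟨z, hz, rfl⟩
    rintro _ ⟨z, hz, rfl⟩ ⟨t, ht⟩
    refine connectedComponentIn_subset _ _ hz ⟨t, ?_⟩
    rw [Function.comp_apply, ht, e.right_inv (by simp [het])]

theorem isBounded_component (h : IsSphereJordanParam c) (he : e.source = {p}ᶜ)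
    (het : e.target = univ) (hp : p ∉ range c) (hx : x ∉ range c)
    (hxp : x ∉ connectedComponentIn (range c)ᶜ p) :
    Bornology.IsBounded (connectedComponentIn (range (e ∘ c))ᶜ (e x)) := by
  rw [← image_component he het hp hx hxp]
  have hK : IsCompact (connectedComponentIn (range c)ᶜ p)ᶜ :=
    (h.isOpen_component p).isClosed_compl.isCompact
  refine (hK.image_of_continuousOn (e.continuousOn.mono fun z hz => ?_)).isBounded.subset
    (image_mono (disjoint_component hx hxp).subset_compl_right)
  rw [he]
  rintro rfl
  exact hz (mem_connectedComponentIn hp)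

theorem mem_component (h : IsSphereJordanParam c) (hp : p ∉ range c) (hx : x ∉ range c)
    (hxp : x ∉ connectedComponentIn (range c)ᶜ p) (hy : y ∉ range c)
    (hyp : y ∉ connectedComponentIn (range c)ᶜ p) : y ∈ connectedComponentIn (range c)ᶜ x := by
  obtain ⟨e, he, het⟩ := exists_openPartialHomeomorph_sphere p
  have hpp : p ∈ connectedComponentIn (range c)ᶜ p := mem_connectedComponentIn hp
  have hsub : ∀ z, z ∉ range c → z ∉ connectedComponentIn (range c)ᶜ p →
      z ∈ e.source ∧ e z ∉ range (e ∘ c) := fun z hz hzp => by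
    have hzs : z ∈ e.source := by
      rw [he]
      rintro rfl
      exact hzp hpp
    refine ⟨hzs, ?_⟩
    rintro ⟨t, ht⟩
    refine hz ⟨t, e.injOn ?_ hzs ht⟩
    rw [he]
    exact fun ht => hp ⟨t, ht⟩
  have := (h.comp he hp).mem_connectedComponentIn_of_isBounded (hsub x hx hxp).2 (hsub y hy hyp).2
    (h.isBounded_component he het hp hx hxp) (h.isBounded_component he het hp hy hyp)
  rw [← image_component he het hp hx hxp] at this
  obtain ⟨z, hz, hzy⟩ := this
  have hzp := Set.disjoint_left.1 (disjoint_component hx hxp) hz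
  rwa [← e.injOn (hsub z (connectedComponentIn_subset _ _ hz) hzp).1 (hsub y hy hyp).1 hzy]

theorem exists_notMem_component (h : IsSphereJordanParam c) :
    ∃ p x, p ∉ range c ∧ x ∉ range c ∧ x ∉ connectedComponentIn (range c)ᶜ p := by
  obtain ⟨p, hp⟩ := (ne_univ_iff_exists_notMem _).1 h.range_ne_univ
  obtain ⟨e, he, het⟩ := exists_openPartialHomeomorph_sphere p
  have hJ := h.comp he hp
  have hcl := hJ.isCompact_range.isClosed
  obtain ⟨z, hz, hb⟩ : ∃ z ∉ range (e ∘ c),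
      Bornology.IsBounded (connectedComponentIn (range (e ∘ c))ᶜ z) := by
    by_contra! hcon
    obtain ⟨R, hR⟩ := hJ.isCompact_range.isBounded.subset_closedBall 0
    have hfar : ∀ z ∉ range (e ∘ c), ∃ w ∈ connectedComponentIn (range (e ∘ c))ᶜ z, R < ‖w‖ := by
      intro z hz
      by_contra! hw
      exact hcon z hz (isBounded_closedBall.subset fun w hwz => mem_closedBall_zero_iff.2 (hw w hwz))
    refine hJ.not_isPreconnected_compl (isPreconnected_of_forall_joinedIn fun z hz w hw => ?_)
    obtain ⟨z', hz', hzR⟩ := hfar z hz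
    obtain ⟨w', hw', hwR⟩ := hfar w hw
    exact ((joinedIn_of_mem_connectedComponentIn hcl hz').trans
      (joinedIn_compl_of_norm_gt hcl hR hzR hwR)).trans
      (joinedIn_of_mem_connectedComponentIn hcl hw').symm
  set U := connectedComponentIn (range (e ∘ c))ᶜ z
  have hUo : IsOpen U := hcl.isOpen_compl.connectedComponentIn
  have hcont : Continuous e.symm := by
    rw [← continuousOn_univ, ← het]
    exact e.continuousOn_symm
  have hsp : ∀ w, e.symm w ≠ p := fun w hw => by
    have := e.map_target (x := w) (by simp [het])
    rw [he] at this
    exact this hw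
  have hinv : ∀ w, e (e.symm w) = w := fun w => e.right_inv (by simp [het])
  have hV : IsOpen (e.symm '' U) :=
    e.symm.isOpen_image_of_subset_source hUo (by simp [het])
  have hV' : IsClosed (e.symm '' closure U) := (hb.isCompact_closure.image hcont).isClosed
  have hzU : z ∈ U := mem_connectedComponentIn hz
  have hezc : e.symm z ∉ range c := by
    rintro ⟨t, ht⟩
    exact hz ⟨t, by rw [Function.comp_apply, ht, hinv]⟩
  refine ⟨p, e.symm z, hp, hezc, fun hmem => ?_⟩
  have hcov : connectedComponentIn (range c)ᶜ p ⊆ e.symm '' U ∪ (e.symm '' closure U)ᶜ := by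
    intro w hw
    by_contra! hcon
    rw [mem_union, not_or, notMem_compl_iff] at hcon
    obtain ⟨hwU, w', hw', rfl⟩ := hcon
    have hwf : w' ∈ frontier U := by
      rw [hUo.frontier_eq]
      exact ⟨hw', fun hw => hwU ⟨w', hw, rfl⟩⟩
    obtain ⟨t, rfl⟩ := frontier_connectedComponentIn_subset hcl z hwf
    refine connectedComponentIn_subset _ _ hw ⟨t, (e.left_inv ?_).symm⟩
    rw [he]
    exact fun ht => hp ⟨t, ht⟩
  have hpU : p ∉ e.symm '' closure U := by
    rintro ⟨w, -, hw⟩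
    exact hsp w hw
  obtain ⟨w, -, ⟨w', hw', hww⟩, hw2⟩ :=
    isPreconnected_connectedComponentIn (e.symm '' U) (e.symm '' closure U)ᶜ hV hV'.isOpen_compl
      hcov ⟨_, hmem, z, hzU, rfl⟩ ⟨p, mem_connectedComponentIn hp, hpU⟩
  exact hw2 ⟨w', subset_closure hw', hww⟩

theorem exists_closedBall (h : IsSphereJordanParam c) (hp : p ∉ range c) (hx : x ∉ range c)
    (hxp : x ∉ connectedComponentIn (range c)ᶜ p) :
    ∃ H : ℂ → Sph, ContinuousOn H (closedBall 0 1) ∧ InjOn H (closedBall 0 1) ∧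
      H '' sphere 0 1 = range c ∧ H '' ball 0 1 = connectedComponentIn (range c)ᶜ x := by
  obtain ⟨e, he, het⟩ := exists_openPartialHomeomorph_sphere p
  have hsymm : ∀ S ⊆ e.source, e.symm '' (e '' S) = S := fun S hS => by
    rw [← image_comp]
    exact (image_congr fun z hz => e.left_inv (hS hz)).trans (image_id S)
  have hsub : connectedComponentIn (range c)ᶜ x ⊆ e.source := fun z hz => by
    rw [he]
    rintro rfl
    exact (disjoint_component hx hxp).le_bot ⟨hz, mem_connectedComponentIn hp⟩
  have hcs : range c ⊆ e.source := fun z hz => by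
    rw [he]
    rintro rfl
    exact hp hz
  have hxs : e x ∉ range (e ∘ c) := by
    rintro ⟨t, ht⟩
    exact hx ⟨t, e.injOn (hcs ⟨t, rfl⟩) (hsub (mem_connectedComponentIn hx)) ht⟩
  obtain ⟨H, hHc, hHi, hHs, hHb⟩ :=
    (h.comp he hp).exists_closedBall hxs (h.isBounded_component he het hp hx hxp)
  have hcont : Continuous e.symm := by
    rw [← continuousOn_univ, ← het]
    exact e.continuousOn_symm
  refine ⟨e.symm ∘ H, hcont.comp_continuousOn hHc, ?_, ?_, ?_⟩
  · intro z hz w hw hzw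
    exact hHi hz hw (e.symm.injOn (by simp [het]) (by simp [het]) hzw)
  · rw [image_comp, hHs, range_comp, hsymm _ hcs]
  · rw [image_comp, hHb, ← image_component he het hp hx hxp, hsymm _ hsub]

end IsSphereJordanParam

end Sphere

section Gluing

/-- The radial extension of a homeomorphism of the unit circle to the unit disc. -/
noncomputable def cone (σ : ℂ → ℂ) (z : ℂ) : ℂ := ‖z‖ * σ (z / ‖z‖)

theorem norm_div_norm_eq_one {z : ℂ} (hz : z ≠ 0) : ‖z / (‖z‖ : ℂ)‖ = 1 := by
  rw [norm_div, Complex.norm_real, norm_norm, div_self (norm_ne_zero_iff.2 hz)]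

section

variable {σ : ℂ → ℂ}

theorem norm_cone (hσ : MapsTo σ (sphere 0 1) (sphere 0 1)) (z : ℂ) : ‖cone σ z‖ = ‖z‖ := by
  rcases eq_or_ne z 0 with rfl | hz
  · simp [cone]
  · have : ‖σ (z / ‖z‖)‖ = 1 := mem_sphere_zero_iff_norm.1
      (hσ (mem_sphere_zero_iff_norm.2 (norm_div_norm_eq_one hz)))
    rw [cone, norm_mul, this, mul_one, Complex.norm_real, norm_norm]

theorem cone_eq_of_norm_eq_one {z : ℂ} (hz : ‖z‖ = 1) : cone σ z = σ z := by
  simp [cone, hz]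

theorem continuous_cone (hσ : MapsTo σ (sphere 0 1) (sphere 0 1))
    (hc : ContinuousOn σ (sphere 0 1)) : Continuous (cone σ) := by
  rw [continuous_iff_continuousAt]
  intro z
  rcases eq_or_ne z 0 with rfl | hz
  · have h0 : cone σ 0 = 0 := by simp [cone]
    rw [ContinuousAt, h0, tendsto_zero_iff_norm_tendsto_zero]
    simp only [norm_cone hσ]
    exact tendsto_norm_zero
  · have hn : ContinuousOn (fun z : ℂ => (‖z‖ : ℂ)) {0}ᶜ := by fun_prop
    have : ContinuousOn (cone σ) {0}ᶜ := by
      refine hn.mul (hc.comp (continuousOn_id.div hn fun w hw => ?_) fun w hw => ?_)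
      · simpa using hw
      · exact mem_sphere_zero_iff_norm.2 (norm_div_norm_eq_one hw)
    exact this.continuousAt (isOpen_compl_singleton.mem_nhds hz)

theorem injective_cone (hσ : MapsTo σ (sphere 0 1) (sphere 0 1)) (hi : InjOn σ (sphere 0 1)) :
    Function.Injective (cone σ) := by
  intro z w hzw
  have hn : ‖z‖ = ‖w‖ := by rw [← norm_cone hσ z, hzw, norm_cone hσ]
  rcases eq_or_ne z 0 with rfl | hz
  · rw [norm_zero] at hn
    exact (norm_eq_zero.1 hn.symm).symm
  have hw : w ≠ 0 := by
    rintro rfl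
    exact hz (norm_eq_zero.1 (hn.trans norm_zero))
  have hz0 : (‖z‖ : ℂ) ≠ 0 := by simpa using hz
  rw [cone, cone, ← hn] at hzw
  have := hi (mem_sphere_zero_iff_norm.2 (norm_div_norm_eq_one hz))
    (mem_sphere_zero_iff_norm.2 (hn ▸ norm_div_norm_eq_one hw)) (mul_left_cancel₀ hz0 hzw)
  field_simp at this
  exact this

theorem cone_image_ball (hσ : σ '' sphere 0 1 = sphere 0 1) :
    cone σ '' ball 0 1 = ball 0 1 := by
  have hm : MapsTo σ (sphere 0 1) (sphere 0 1) := mapsTo_iff_image_subset.2 hσ.subset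
  refine Subset.antisymm ?_ fun w hw => ?_
  · rintro _ ⟨z, hz, rfl⟩
    rwa [mem_ball_zero_iff, norm_cone hm, ← mem_ball_zero_iff]
  · rcases eq_or_ne w 0 with rfl | hw0
    · exact ⟨0, hw, by simp [cone]⟩
    · obtain ⟨u, hu, huw⟩ :=
        hσ.superset (mem_sphere_zero_iff_norm.2 (norm_div_norm_eq_one hw0))
      have hu1 := mem_sphere_zero_iff_norm.1 hu
      have hn : ‖(‖w‖ : ℂ) * u‖ = ‖w‖ := by simp [hu1]
      have hw0' : (‖w‖ : ℂ) ≠ 0 := by simpa using hw0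
      refine ⟨‖w‖ * u, by rwa [mem_ball_zero_iff, hn, ← mem_ball_zero_iff], ?_⟩
      rw [cone, hn, mul_div_cancel_left₀ _ hw0', huw, mul_div_cancel₀ _ hw0']

end

/-- An embedding of the closed disc can be reparametrised so as to agree on the circle with a given
one having the same boundary. -/
theorem exists_eqOn_sphere {X : Type*} [TopologicalSpace X] [T2Space X] {H K : ℂ → X}
    (hHc : ContinuousOn H (closedBall 0 1)) (hHi : InjOn H (closedBall 0 1))
    (hKc : ContinuousOn K (closedBall 0 1)) (hKi : InjOn K (closedBall 0 1))
    (hHK : H '' sphere 0 1 = K '' sphere 0 1) :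
    ∃ L : ℂ → X, ContinuousOn L (closedBall 0 1) ∧ InjOn L (closedBall 0 1) ∧
      EqOn L H (sphere 0 1) ∧ L '' ball 0 1 = K '' ball 0 1 := by
  have hsub : sphere (0 : ℂ) 1 ⊆ closedBall 0 1 := sphere_subset_closedBall
  obtain ⟨G, hGc, hG⟩ := exists_continuousOn_comp_eq (isCompact_sphere (0 : ℂ) 1)
    (hKc.mono hsub) (continuousOn_id (s := sphere (0 : ℂ) 1))
    fun s hs t ht hst => hKi (hsub hs) (hsub ht) hst
  have hHm : ∀ z ∈ sphere (0 : ℂ) 1, ∃ w ∈ sphere (0 : ℂ) 1, K w = H z := fun z hz =>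
    hHK.subset ⟨z, hz, rfl⟩
  have hKG : ∀ z ∈ sphere (0 : ℂ) 1, G (H z) ∈ sphere (0 : ℂ) 1 ∧ K (G (H z)) = H z := by
    intro z hz
    obtain ⟨w, hw, hwz⟩ := hHm z hz
    rw [← hwz, hG w hw]
    exact ⟨hw, rfl⟩
  have hσm : MapsTo (G ∘ H) (sphere 0 1) (sphere 0 1) := fun z hz => (hKG z hz).1
  have hσc : ContinuousOn (G ∘ H) (sphere 0 1) :=
    hGc.comp (hHc.mono hsub) fun z hz => hHm z hz
  have hσi : InjOn (G ∘ H) (sphere 0 1) := fun z hz w hw hzw => by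
    refine hHi (hsub hz) (hsub hw) ?_
    rw [← (hKG z hz).2, ← (hKG w hw).2]
    exact congrArg K hzw
  have hσs : (G ∘ H) '' sphere 0 1 = sphere 0 1 := by
    refine Subset.antisymm (mapsTo_iff_image_subset.1 hσm) fun w hw => ?_
    obtain ⟨z, hz, hzw⟩ := hHK.superset ⟨w, hw, rfl⟩
    exact ⟨z, hz, by rw [Function.comp_apply, hzw, hG w hw]; rfl⟩
  have hτ : MapsTo (cone (G ∘ H)) (closedBall 0 1) (closedBall 0 1) := fun z hz => by
    rwa [mem_closedBall_zero_iff, norm_cone hσm, ← mem_closedBall_zero_iff]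
  refine ⟨K ∘ cone (G ∘ H), hKc.comp (continuous_cone hσm hσc).continuousOn hτ,
    hKi.comp (injective_cone hσm hσi).injOn hτ, fun z hz => ?_, ?_⟩
  · rw [Function.comp_apply, cone_eq_of_norm_eq_one (mem_sphere_zero_iff_norm.1 hz)]
    exact (hKG z hz).2
  · rw [image_comp, cone_image_ball hσs]

/-- The orthogonal projection of the sphere to the plane of the equator. -/
noncomputable def equatorProj (x : Sph) : ℂ := ⟨x.1 0, x.1 1⟩

theorem continuous_equatorProj : Continuous equatorProj := by
  have h : equatorProj = fun x : Sph => (x.1 0 : ℂ) + (x.1 1 : ℂ) * Complex.I := by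
    ext x
    simp [equatorProj, Complex.mk_eq_add_mul_I]
  rw [h]
  fun_prop

theorem norm_equatorProj_sq_add (x : Sph) : ‖equatorProj x‖ ^ 2 + x.1 2 ^ 2 = 1 := by
  have h1 : ‖x.1‖ ^ 2 = 1 := by rw [mem_sphere_zero_iff_norm.1 x.2, one_pow]
  rw [EuclideanSpace.norm_sq_eq, Fin.sum_univ_three] at h1
  simp only [Real.norm_eq_abs, sq_abs] at h1
  rw [← Complex.normSq_eq_norm_sq, Complex.normSq_apply, ← h1]
  simp only [equatorProj]
  ring

theorem equatorProj_mem_closedBall (x : Sph) : equatorProj x ∈ closedBall (0 : ℂ) 1 := by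
  rw [mem_closedBall_zero_iff, ← sq_le_one_iff₀ (norm_nonneg _)]
  nlinarith [norm_equatorProj_sq_add x, sq_nonneg (x.1 2)]

theorem equatorProj_mem_sphere_iff {x : Sph} : equatorProj x ∈ sphere (0 : ℂ) 1 ↔ x.1 2 = 0 := by
  have h := norm_equatorProj_sq_add x
  rw [mem_sphere_zero_iff_norm, ← sq_eq_zero_iff, ← sq_eq_sq₀ (norm_nonneg _) zero_le_one]
  constructor <;> intro h' <;> linarith

theorem eq_of_equatorProj_eq {x y : Sph} (h : equatorProj x = equatorProj y)
    (hxy : 0 ≤ x.1 2 * y.1 2) : x = y := by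
  have h2 : x.1 2 = y.1 2 := by
    have hx := norm_equatorProj_sq_add x
    have hy := norm_equatorProj_sq_add y
    rw [h] at hx
    have hsq : x.1 2 ^ 2 = y.1 2 ^ 2 := by linarith
    rcases sq_eq_sq_iff_eq_or_eq_neg.1 hsq with h | h
    · exact h
    · rw [h] at hxy ⊢
      nlinarith
  ext i
  fin_cases i
  · exact congrArg Complex.re h
  · exact congrArg Complex.im h
  · exact h2

theorem exists_equatorProj_eq {z : ℂ} (hz : z ∈ closedBall (0 : ℂ) 1) (s : ℝ) (hs : s ^ 2 = 1) :
    ∃ x : Sph, equatorProj x = z ∧ 0 ≤ s * x.1 2 := by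
  have hz1 : ‖z‖ ^ 2 ≤ 1 := (sq_le_one_iff₀ (norm_nonneg _)).2 (mem_closedBall_zero_iff.1 hz)
  have hq := Real.sq_sqrt (sub_nonneg.2 hz1)
  refine ⟨⟨!₂[z.re, z.im, s * √(1 - ‖z‖ ^ 2)], ?_⟩, ?_, ?_⟩
  · rw [mem_sphere_zero_iff_norm, ← sq_eq_sq₀ (norm_nonneg _) zero_le_one,
      EuclideanSpace.norm_sq_eq, Fin.sum_univ_three]
    rw [← Complex.normSq_eq_norm_sq, Complex.normSq_apply] at hq
    simp [← Complex.normSq_eq_norm_sq, Complex.normSq_apply, mul_pow, hs] at hq ⊢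
    rw [hq]
    ring
  · simp [equatorProj]
  · have : 0 ≤ s ^ 2 * √(1 - ‖z‖ ^ 2) := by positivity
    simpa [← mul_assoc, ← sq] using this

/-- Two discs with a common boundary and disjoint interiors covering a space make it a sphere. -/
theorem exists_homeomorph_of_discs {X : Type*} [TopologicalSpace X] [T2Space X] {H L : ℂ → X}
    (hHc : ContinuousOn H (closedBall 0 1)) (hHi : InjOn H (closedBall 0 1))
    (hLc : ContinuousOn L (closedBall 0 1)) (hLi : InjOn L (closedBall 0 1))
    (hHL : EqOn L H (sphere 0 1)) (hdisj : Disjoint (H '' closedBall 0 1) (L '' ball 0 1))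
    (hcov : ∀ x, x ∈ H '' closedBall 0 1 ∨ x ∈ L '' ball 0 1) :
    ∃ F : Sph ≃ₜ X, F '' equator = H '' sphere 0 1 := by
  classical
  let F : Sph → X := fun x =>
    if 0 ≤ x.1 2 then H (equatorProj x) else L (equatorProj x)
  have hFp : ∀ x : Sph, 0 ≤ x.1 2 → F x = H (equatorProj x) := fun x hx => if_pos hx
  have hFn : ∀ x : Sph, x.1 2 < 0 → F x = L (equatorProj x) := fun x hx => if_neg hx.not_ge
  have hball : ∀ x : Sph, x.1 2 ≠ 0 → equatorProj x ∈ ball (0 : ℂ) 1 := fun x hx =>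
    mem_ball_zero_iff.2 ((mem_closedBall_zero_iff.1 (equatorProj_mem_closedBall x)).lt_of_ne
      fun h => hx (equatorProj_mem_sphere_iff.1 (mem_sphere_zero_iff_norm.2 h)))
  have hFc : Continuous F := by
    refine continuous_if_le continuous_const (by fun_prop)
      (hHc.comp continuous_equatorProj.continuousOn fun x _ => equatorProj_mem_closedBall x)
      (hLc.comp continuous_equatorProj.continuousOn fun x _ => equatorProj_mem_closedBall x)
      fun x hx => (hHL (equatorProj_mem_sphere_iff.2 hx.symm)).symm
  have hne : ∀ x y : Sph, 0 ≤ x.1 2 → y.1 2 < 0 → F x ≠ F y := by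
    intro x y hx hy hxy
    rw [hFp x hx, hFn y hy] at hxy
    exact Set.disjoint_left.1 hdisj ⟨_, equatorProj_mem_closedBall x, hxy⟩ ⟨_, hball y hy.ne, rfl⟩
  have hFi : Function.Injective F := by
    intro x y hxy
    rcases le_or_gt 0 (x.1 2) with hx | hx <;> rcases le_or_gt 0 (y.1 2) with hy | hy
    · rw [hFp x hx, hFp y hy] at hxy
      exact eq_of_equatorProj_eq (hHi (equatorProj_mem_closedBall x)
        (equatorProj_mem_closedBall y) hxy) (mul_nonneg hx hy)
    · exact absurd hxy (hne x y hx hy)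
    · exact absurd hxy.symm (hne y x hy hx)
    · rw [hFn x hx, hFn y hy] at hxy
      exact eq_of_equatorProj_eq (hLi (equatorProj_mem_closedBall x)
        (equatorProj_mem_closedBall y) hxy) (mul_nonneg_of_nonpos_of_nonpos hx.le hy.le)
  have hFs : Function.Surjective F := by
    intro y
    rcases hcov y with ⟨z, hz, rfl⟩ | ⟨z, hz, rfl⟩
    · obtain ⟨x, rfl, hx⟩ := exists_equatorProj_eq hz 1 (one_pow 2)
      exact ⟨x, hFp x (by simpa using hx)⟩
    · obtain ⟨x, rfl, hx⟩ := exists_equatorProj_eq (ball_subset_closedBall hz) (-1) (by norm_num)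
      refine ⟨x, hFn x (lt_of_le_of_ne (by simpa using hx) fun h0 => ?_)⟩
      have := mem_sphere_zero_iff_norm.1 (equatorProj_mem_sphere_iff.2 h0)
      exact (mem_ball_zero_iff.1 hz).ne this
  refine ⟨Continuous.homeoOfEquivCompactToT2 (f := Equiv.ofBijective F ⟨hFi, hFs⟩) hFc, ?_⟩
  change F '' equator = _
  refine Subset.antisymm ?_ ?_
  · rintro _ ⟨x, hx, rfl⟩
    exact ⟨equatorProj x, equatorProj_mem_sphere_iff.2 hx, (hFp x (le_of_eq hx.symm)).symm⟩
  · rintro _ ⟨z, hz, rfl⟩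
    obtain ⟨x, rfl, hx⟩ := exists_equatorProj_eq (sphere_subset_closedBall hz) 1 (one_pow 2)
    exact ⟨x, equatorProj_mem_sphere_iff.1 hz, hFp x (by simpa using hx)⟩

end Gluing

theorem exists_isSphereJordanParam {g : Circle2 → Sph} (hg : Continuous g)
    (hi : Function.Injective g) : ∃ c, IsSphereJordanParam c ∧ range c = range g := by
  let b : ℝ → Circle2 := fun t =>
    ⟨!₂[Real.cos (2 * Real.pi * t), Real.sin (2 * Real.pi * t)], by
      rw [mem_sphere_zero_iff_norm, EuclideanSpace.norm_eq, Real.sqrt_eq_one]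
      simp⟩
  have hbc : Continuous b := by
    refine Continuous.subtype_mk ?_ _
    fun_prop
  have hb : ∀ s t, b s = b t ↔ ∃ n : ℤ, s = t + n := by
    intro s t
    have h1 : b s = b t ↔ Real.cos (2 * Real.pi * s) = Real.cos (2 * Real.pi * t) ∧
        Real.sin (2 * Real.pi * s) = Real.sin (2 * Real.pi * t) := by
      simp [b, Subtype.ext_iff]
    rw [h1]
    constructor
    · rintro ⟨hcos, hsin⟩
      obtain ⟨k, hk⟩ := Real.Angle.angle_eq_iff_two_pi_dvd_sub.1 (Real.Angle.cos_sin_inj hcos hsin)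
      refine ⟨k, mul_left_cancel₀ Real.two_pi_pos.ne' ?_⟩
      linarith
    · rintro ⟨k, rfl⟩
      rw [mul_add, mul_comm _ (k : ℝ)]
      exact ⟨Real.cos_add_int_mul_two_pi _ _, Real.sin_add_int_mul_two_pi _ _⟩
  have hbs : Function.Surjective b := by
    intro x
    have hx : x.1 0 ^ 2 + x.1 1 ^ 2 = 1 := by
      have h1 : ‖x.1‖ ^ 2 = 1 := by rw [mem_sphere_zero_iff_norm.1 x.2, one_pow]
      rwa [EuclideanSpace.norm_sq_eq, Fin.sum_univ_two, Real.norm_eq_abs, Real.norm_eq_abs,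
        sq_abs, sq_abs] at h1
    set z : ℂ := ⟨x.1 0, x.1 1⟩
    have hz : ‖z‖ = 1 := by
      rw [← sq_eq_sq₀ (norm_nonneg _) zero_le_one, ← Complex.normSq_eq_norm_sq,
        Complex.normSq_apply]
      simp only [z]
      linarith
    have hz0 : z ≠ 0 := norm_ne_zero_iff.1 (by rw [hz]; exact one_ne_zero)
    have h2 : 2 * Real.pi * (z.arg / (2 * Real.pi)) = z.arg :=
      mul_div_cancel₀ _ Real.two_pi_pos.ne'
    refine ⟨z.arg / (2 * Real.pi), ?_⟩
    ext i
    fin_cases i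
    · simp [b, h2, Complex.cos_arg hz0, hz, z]
    · simp [b, h2, Complex.sin_arg, hz, z]
  refine ⟨g ∘ b, ⟨hg.comp hbc, fun s t => ?_⟩, hbs.range_comp g⟩
  rw [← hb]
  exact hi.eq_iff

theorem stmt_6 (γ : Set Sph)
    (hγ : ∃ g : Circle2 → Sph, Continuous g ∧ Function.Injective g ∧ range g = γ) :
    ∃ f : Sph ≃ₜ Sph, f '' γ = equator := by
  obtain ⟨g, hg, hgi, rfl⟩ := hγ
  obtain ⟨c, hc, hcg⟩ := exists_isSphereJordanParam hg hgi
  rw [← hcg]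
  obtain ⟨p, q, hp, hq, hqp⟩ := hc.exists_notMem_component
  have hdisj := IsSphereJordanParam.disjoint_component hq hqp
  have hpq : p ∉ connectedComponentIn (range c)ᶜ q := fun h =>
    hdisj.le_bot ⟨h, mem_connectedComponentIn hp⟩
  obtain ⟨H, hHc, hHi, hHs, hHb⟩ := hc.exists_closedBall hp hq hqp
  obtain ⟨K, hKc, hKi, hKs, hKb⟩ := hc.exists_closedBall hq hp hpq
  obtain ⟨L, hLc, hLi, hLH, hLb⟩ := exists_eqOn_sphere hHc hHi hKc hKi (hHs.trans hKs.symm)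
  have hHcl : H '' closedBall 0 1 = connectedComponentIn (range c)ᶜ q ∪ range c := by
    rw [← ball_union_sphere, image_union, hHb, hHs]
  obtain ⟨F, hF⟩ := exists_homeomorph_of_discs hHc hHi hLc hLi hLH
    (by
      rw [hHcl, hLb, hKb]
      exact hdisj.union_left
        (Set.disjoint_left.2 fun z hz hz' => connectedComponentIn_subset _ _ hz' hz))
    (fun x => by
      rw [hHcl, hLb, hKb]
      by_cases hx : x ∈ range c
      · exact Or.inl (Or.inr hx)
      by_cases hxp : x ∈ connectedComponentIn (range c)ᶜ p
      · exact Or.inr hxp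
      · exact Or.inl (Or.inl (hc.mem_component hp hq hqp hx hxp)))
  refine ⟨F.symm, ?_⟩
  rw [← hHs, ← hF, ← image_comp]
  simp
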